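/- arXiv:1004.4224 — 3 statements merged into one kernel-verified Lean document; each statement's English description precedes it below -/
import Mathlib

section
/- Let M be a nonzero finitely generated graded module of dimension l over a Noetherian graded ring R (finitely generated over an Artinian local ring R_0). Then there exist positive integers s_1,...,s_l and a Laurent polynomial p(t) with integer coefficients satisfying p(1) ≠ 0 such that the Hilbert series of M equals p(t) / ∏_{i=1}^{l} (1 - t^{s_i}). -/
section series
open Polynomial

/-- polynomials as Laurent series -/
noncomputable def toL : ℤ[X] →+* LaurentSeries ℤ :=
  (HahnSeries.ofPowerSeries ℤ ℤ).comp Polynomial.coeToPowerSeries.ringHom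

noncomputable def tt (k : ℤ) : LaurentSeries ℤ := HahnSeries.single k 1

lemma tt_add (a b : ℤ) : tt (a + b) = tt a * tt b := by
  simp [tt]

lemma toL_X_pow (n : ℕ) : toL (X ^ n) = tt n := by
  simp [toL, tt, HahnSeries.ofPowerSeries_X_pow]

lemma tt_coeff (k : ℤ) (P : LaurentSeries ℤ) (n : ℤ) : (tt k * P).coeff n = P.coeff (n - k) := by
  have := HahnSeries.coeff_single_mul_add (r := (1:ℤ)) (x := P) (a := n - k) (b := k)
  simpa [tt] using this

lemma toL_coeff (q : ℤ[X]) (n : ℤ) :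
    (toL q).coeff n = if n < 0 then 0 else q.coeff n.natAbs := by
  have := PowerSeries.coeff_coe (q : PowerSeries ℤ) n
  simpa [toL] using this

lemma toL_support_subset (q : ℤ[X]) :
    Function.support (toL q).coeff ⊆ (q.support.map Nat.castEmbedding : Finset ℤ) := by
  intro n hn
  rw [Function.mem_support, toL_coeff] at hn
  split_ifs at hn with h
  · exact absurd rfl hn
  · simp only [Finset.coe_map, Set.mem_image, Finset.mem_coe, mem_support_iff]
    exact ⟨n.natAbs, hn, by simp; omega⟩

lemma toL_support (q : ℤ[X]) : (toL q).support.Finite :=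
  (Finset.finite_toSet _).subset (toL_support_subset q)

lemma toL_sum (q : ℤ[X]) : ∑ᶠ n, (toL q).coeff n = q.eval 1 := by
  rw [finsum_eq_sum_of_support_subset _ (toL_support_subset q), eval_eq_sum, Polynomial.sum]
  simp [toL_coeff, Nat.cast_nonneg, not_lt.mpr]

def Good (l : ℕ) (P : LaurentSeries ℤ) : Prop :=
  ∃ (a : ℕ) (k : ℤ) (q : ℤ[X]), 0 < a ∧ 0 < q.eval 1 ∧ P * toL ((1 - X ^ a) ^ l) = tt k * toL q

def Weak (l : ℕ) (P : LaurentSeries ℤ) : Prop :=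
  ∃ (a : ℕ) (k : ℤ) (q : ℤ[X]), 0 < a ∧ 0 ≤ q.eval 1 ∧ P * toL ((1 - X ^ a) ^ l) = tt k * toL q

lemma Good.weak {l P} (h : Good l P) : Weak l P := by
  obtain ⟨a, k, q, ha, hq, h⟩ := h
  exact ⟨a, k, q, ha, hq.le, h⟩

lemma geomF (a b : ℕ) (hb : 0 < b) : ∃ g : ℤ[X], (1 - X ^ a) * g = 1 - X ^ (a * b) ∧ 0 < g.eval 1 := by
  refine ⟨∑ i ∈ Finset.range b, (X ^ a) ^ i, ?_, ?_⟩
  · rw [mul_neg_geom_sum, pow_mul]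
  · simp [Polynomial.eval_finsetSum, hb]

lemma Weak.succ {l P} (h : Weak l P) : Weak (l + 1) P := by
  obtain ⟨a, k, q, ha, hq, h⟩ := h
  refine ⟨a, k, q * (1 - X ^ a), ha, by simp, ?_⟩
  rw [pow_succ, map_mul, ← mul_assoc, h, map_mul, mul_assoc]

lemma Weak.mono {l l' P} (h : Weak l P) (hl : l ≤ l') : Weak l' P := by
  induction hl with
  | refl => exact h
  | step _ ih => exact ih.succ

lemma Good.add {l P P'} (h : Good l P) (h' : Weak l P') : Good l (P + P') := by
  obtain ⟨a, k, q, ha, hq, h⟩ := h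
  obtain ⟨a', k', q', ha', hq', h'⟩ := h'
  obtain ⟨g, hg, hg1⟩ := geomF a a' ha'
  obtain ⟨g', hg', hg1'⟩ := geomF a' a ha
  obtain ⟨j, m, m', hm, hm'⟩ : ∃ (j : ℤ) (m m' : ℕ), k = j + m ∧ k' = j + m' :=
    ⟨min k k', (k - min k k').toNat, (k' - min k k').toNat, by omega, by omega⟩
  refine ⟨a * a', j, X ^ m * q * g ^ l + X ^ m' * q' * g' ^ l, by positivity, ?_, ?_⟩
  · simp only [eval_add, eval_mul, eval_pow, eval_X, one_pow, one_mul]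
    positivity
  · rw [add_mul]
    nth_rewrite 2 [mul_comm a a']
    rw [← hg, ← hg', mul_pow, mul_pow, map_mul, map_mul, ← mul_assoc, ← mul_assoc, h, h']
    rw [hm, hm', tt_add, tt_add, map_add, map_mul, map_mul, map_mul, map_mul, toL_X_pow,
      toL_X_pow]
    ring

lemma Good.add_max {l l' P P'} (h : Good l P) (h' : Good l' P') : Good (max l l') (P + P') := by
  rcases le_total l l' with hl | hl
  · rw [max_eq_right hl, add_comm]
    exact h'.add (h.weak.mono hl)
  · rw [max_eq_left hl]
    exact h.add (h'.weak.mono hl)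

lemma Good.shift {l P} (h : Good l P) (d : ℤ) : Good l (tt d * P) := by
  obtain ⟨a, k, q, ha, hq, h⟩ := h
  refine ⟨a, d + k, q, ha, hq, ?_⟩
  rw [mul_assoc, h, tt_add, mul_assoc]

lemma Good.succ {l P} {s : ℕ} (hs : 0 < s) (h : Good l (P * toL (1 - X ^ s))) : Good (l + 1) P := by
  obtain ⟨a, k, q, ha, hq, h⟩ := h
  obtain ⟨g, hg, hg1⟩ := geomF s a ha
  obtain ⟨g', hg', hg1'⟩ := geomF a s hs
  refine ⟨s * a, k, q * g * g' ^ l, by positivity, ?_, ?_⟩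
  · simp only [eval_mul, eval_pow]
    positivity
  · rw [pow_succ]
    nth_rewrite 1 [mul_comm s a]
    rw [← hg, ← hg', map_mul, mul_pow, map_mul, map_mul]
    rw [mul_assoc q, map_mul, ← mul_assoc (tt k), ← h, map_mul]
    ring

def HS (f : ℤ → ℕ∞) (P : LaurentSeries ℤ) : Prop :=
  ∀ n, ∃ m : ℕ, f n = m ∧ P.coeff n = m

def GoodF (l : ℕ) (f : ℤ → ℕ∞) : Prop := ∃ P, HS f P ∧ Good l P

lemma HS.unique {f P P'} (h : HS f P) (h' : HS f P') : P = P' := by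
  ext n
  obtain ⟨m, h1, h2⟩ := h n
  obtain ⟨m', h1', h2'⟩ := h' n
  rw [h1] at h1'
  rw [h2, h2']
  exact_mod_cast h1'

lemma GoodF.shift {l f g} (d : ℤ) (hf : GoodF l f) (h : ∀ n, g n = f (n - d)) : GoodF l g := by
  obtain ⟨P, hP, hG⟩ := hf
  refine ⟨tt d * P, fun n => ?_, hG.shift d⟩
  rw [h, tt_coeff]
  exact hP _

lemma GoodF.add_max {l l' f f' g} (hf : GoodF l f) (hf' : GoodF l' f') (h : ∀ n, g n = f n + f' n) :
    GoodF (max l l') g := by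
  obtain ⟨P, hP, hG⟩ := hf
  obtain ⟨P', hP', hG'⟩ := hf'
  refine ⟨P + P', fun n => ?_, hG.add_max hG'⟩
  obtain ⟨m, h1, h2⟩ := hP n
  obtain ⟨m', h1', h2'⟩ := hP' n
  exact ⟨m + m', by rw [h, h1, h1']; simp, by simp [h2, h2']⟩

lemma exists_HS (f : ℤ → ℕ∞) (hf : ∀ n, f n ≠ ⊤) (hf0 : ∀ n < 0, f n = 0) : ∃ P, HS f P := by
  refine ⟨HahnSeries.ofSuppBddBelow (fun n => ((f n).toNat : ℤ)) ⟨0, fun n hn => ?_⟩, fun n => ⟨(f n).toNat, ?_, ?_⟩⟩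
  · by_contra h
    simp [hf0 n (by omega)] at hn
  · exact (ENat.natCast_toNat (hf n)).symm
  · rfl

lemma GoodF.succ {l f g} (s : ℕ) (hs : 0 < s) (hg : GoodF l g) (hf : ∀ n, f n ≠ ⊤)
    (hf0 : ∀ n < 0, f n = 0) (h : ∀ n, f n = g n + f (n - s)) : GoodF (l + 1) f := by
  obtain ⟨P, hP⟩ := exists_HS f hf hf0
  obtain ⟨Q, hQ, hG⟩ := hg
  refine ⟨P, hP, Good.succ hs ?_⟩
  convert hG
  ext n
  rw [map_sub, toL_X_pow, map_one, mul_sub, mul_one, mul_comm, HahnSeries.coeff_sub, tt_coeff]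
  obtain ⟨m, h1, h2⟩ := hP n
  obtain ⟨m', h1', h2'⟩ := hQ n
  obtain ⟨m'', h1'', h2''⟩ := hP (n - s)
  have := h n
  rw [h1, h1', h1''] at this
  norm_cast at this
  rw [h2, h2', h2'', this]
  simp

lemma GoodF.base {f} (hf : f 0 ≠ ⊤) (hf' : f 0 ≠ 0) (h : ∀ n, n ≠ 0 → f n = 0) : GoodF 0 f := by
  obtain ⟨P, hP⟩ := exists_HS f (fun n => by by_cases hn : n = 0 <;> simp_all)
    (fun n hn => h n hn.ne)
  refine ⟨P, hP, 1, 0, C (P.coeff 0), one_pos, ?_, ?_⟩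
  · obtain ⟨m, h1, h2⟩ := hP 0
    rw [h1] at hf'
    simp [h2]
    have : m ≠ 0 := by exact_mod_cast hf'
    omega
  · have : toL (C (P.coeff 0)) = HahnSeries.single 0 (P.coeff 0) := by
      ext n
      rw [toL_coeff, coeff_C]
      by_cases hn : n = 0
      · simp [hn]
      · simp [hn]
    rw [this]
    ext n
    rw [tt_coeff]
    simp only [pow_zero, map_one, mul_one, sub_zero]
    by_cases hn : n = 0
    · simp [hn]
    · obtain ⟨m, h1, h2⟩ := hP n
      rw [h n hn] at h1
      rw [HahnSeries.coeff_single_of_ne hn, h2]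
      exact_mod_cast h1.symm

lemma Good.final {l P} (h : Good l P) : ∃ (s : Fin l → ℕ+) (p : LaurentSeries ℤ),
      p.support.Finite ∧ (∑ᶠ n, p.coeff n) ≠ 0 ∧
        P * ∏ i, (1 - HahnSeries.single ((s i : ℕ) : ℤ) (1 : ℤ)) = p := by
  obtain ⟨a, k, q, ha, hq, h⟩ := h
  refine ⟨fun _ => ⟨a, ha⟩, tt k * toL q, ?_, ?_, ?_⟩
  · refine ((toL_support q).image (fun n => n + k)).subset ?_
    intro n hn
    refine ⟨n - k, ?_, by simp⟩
    simpa [tt_coeff] using hn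
  · have : ∑ᶠ n, (tt k * toL q).coeff n = ∑ᶠ n, (toL q).coeff n := by
      rw [← finsum_comp_equiv (Equiv.subRight k) (f := fun n => (toL q).coeff n)]
      exact finsum_congr fun n => tt_coeff _ _ _
    rw [this, toL_sum]
    exact hq.ne'
  · rw [← h, map_pow, map_sub, map_one, toL_X_pow]
    simp [tt]
end series

lemma poly_max_height {R : Type*} [CommRing R] [IsNoetherianRing R] [IsJacobsonRing R]
    (P : Ideal (Polynomial R)) [hP : P.IsMaximal] :
    (P.comap Polynomial.C).IsMaximal ∧ P.height = (P.comap Polynomial.C).height + 1 := by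
  have h1 := Polynomial.isMaximal_comap_C_of_isJacobsonRing P
  have h : P.LiesOver (P.comap Polynomial.C) := ⟨rfl⟩
  exact ⟨h1, Polynomial.height_eq_height_add_one (P.comap Polynomial.C) P⟩

lemma mvpoly_max_height (k : Type*) [Field k] (n : ℕ) (m : Ideal (MvPolynomial (Fin n) k))
    [hm : m.IsMaximal] : m.height = n := by
  induction n with
  | zero =>
    have h1 : ringKrullDim (MvPolynomial (Fin 0) k) = 0 := by
      rw [MvPolynomial.ringKrullDim_of_isNoetherianRing]; simp
    have := Ideal.height_le_ringKrullDim_of_ne_top hm.ne_top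
    rw [h1] at this
    simpa using this
  | succ n ih =>
    let e := (MvPolynomial.finSuccEquiv k n).toRingEquiv
    let P := m.comap e.symm
    have hP : P.IsMaximal := Ideal.comap_isMaximal_of_equiv e.symm
    obtain ⟨hmax, h⟩ := poly_max_height P
    rw [ih _] at h
    have : P.height = m.height := RingEquiv.height_comap e.symm m
    rw [← this, h]; simp

lemma affine_max_height (k D : Type*) [Field k] [CommRing D] [IsDomain D] [Algebra k D]
    [Algebra.FiniteType k D] (m : Ideal D) [hm : m.IsMaximal] : m.height = ringKrullDim D := by
  obtain ⟨s, g, hg, hgi⟩ := exists_integral_inj_algHom_of_fg k D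
  have : IsNoetherianRing D := Algebra.FiniteType.isNoetherianRing k D
  algebraize [g.toRingHom]
  have hint : Algebra.IsIntegral (MvPolynomial (Fin s) k) D := ⟨hgi⟩
  have : FaithfulSMul (MvPolynomial (Fin s) k) D := (faithfulSMul_iff_algebraMap_injective _ _).mpr hg
  have hn : (m.under (MvPolynomial (Fin s) k)).IsMaximal := inferInstance
  have h1 := Ideal.height_eq_height_add_of_liesOver_of_hasGoingDown
    (m.under (MvPolynomial (Fin s) k)) m
  rw [mvpoly_max_height] at h1
  have h2 : ringKrullDim D ≤ ringKrullDim (MvPolynomial (Fin s) k) := by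
    refine Order.krullDim_le_of_strictMono (PrimeSpectrum.comap (algebraMap _ _)) ?_
    intro p q hpq
    obtain ⟨hle, x, hx, hx'⟩ := SetLike.lt_iff_le_and_exists.mp (show p.asIdeal < q.asIdeal from hpq)
    exact Ideal.comap_lt_comap_of_integral_mem_sdiff hle ⟨hx, hx'⟩ (hint.isIntegral x)
  rw [MvPolynomial.ringKrullDim_of_isNoetherianRing] at h2
  refine le_antisymm (Ideal.height_le_ringKrullDim_of_ne_top hm.ne_top) (h2.trans ?_)
  rw [h1]
  simp
  exact_mod_cast (le_self_add : (s : ℕ∞) ≤ _)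

lemma dim_drop (R₀ : Type*) [CommRing R₀] [IsArtinianRing R₀]
    (A : Type*) [CommRing A] [Algebra R₀ A] [Algebra.FiniteType R₀ A]
    (p : Ideal A) [hp : p.IsPrime] (x : A) (hx : x ∉ p) (hne : p ⊔ Ideal.span {x} ≠ ⊤) :
    ringKrullDim (A ⧸ (p ⊔ Ideal.span {x})) + 1 = ringKrullDim (A ⧸ p) := by
  let K := RingHom.ker (algebraMap R₀ (A ⧸ p))
  have hK : K.IsPrime := RingHom.ker_isPrime _
  have hKm : K.IsMaximal := inferInstance
  let _ : Field (R₀ ⧸ K) := Ideal.Quotient.field K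
  let _ : Algebra (R₀ ⧸ K) (A ⧸ p) := (RingHom.kerLift (algebraMap R₀ (A ⧸ p))).toAlgebra
  have : IsScalarTower R₀ (R₀ ⧸ K) (A ⧸ p) := IsScalarTower.of_algebraMap_eq' rfl
  have : Algebra.FiniteType (R₀ ⧸ K) (A ⧸ p) := Algebra.FiniteType.of_restrictScalars_finiteType R₀ _ _
  have : IsNoetherianRing (A ⧸ p) := Algebra.FiniteType.isNoetherianRing (R₀ ⧸ K) _
  let y := Ideal.Quotient.mk p x
  have hy : y ≠ 0 := fun h => hx (Ideal.Quotient.eq_zero_iff_mem.mp h)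
  let e := DoubleQuot.quotQuotEquivQuotSup p (Ideal.span {x})
  have hmap : (Ideal.span {x}).map (Ideal.Quotient.mk p) = Ideal.span {y} := by
    rw [Ideal.map_span, Set.image_singleton]
  have hne' : Ideal.span {y} ≠ ⊤ := by
    intro h
    apply hne
    rw [← hmap] at h
    rw [← Ideal.Quotient.subsingleton_iff] at h ⊢
    exact e.symm.injective.subsingleton
  obtain ⟨m, hm, hle⟩ := Ideal.exists_le_maximal _ hne'
  have hym : y ∈ m := hle (Ideal.mem_span_singleton_self y)
  have := Module.ringKrullDim_quotient_add_one_of_mem_nonZeroDivisors (mem_nonZeroDivisors_of_ne_zero hy)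
    (affine_max_height (R₀ ⧸ K) (A ⧸ p) m) hym
  rw [← this, ← ringKrullDim_eq_of_ringEquiv e, hmap]

lemma dim_union {A : Type*} [CommRing A] (I J K : Ideal A) (hJ : I ≤ J) (hK : I ≤ K)
    (h : ∀ P : Ideal A, P.IsPrime → I ≤ P → J ≤ P ∨ K ≤ P) :
    ringKrullDim (A ⧸ I) = max (ringKrullDim (A ⧸ J)) (ringKrullDim (A ⧸ K)) := by
  apply le_antisymm
  · have key : ∀ (J : Ideal A) (s : LTSeries (PrimeSpectrum.zeroLocus (I : Set A))),
        J ≤ s.head.1.asIdeal → (s.length : WithBot ℕ∞) ≤ ringKrullDim (A ⧸ J) := by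
      intro J s hs
      rw [ringKrullDim_quotient]
      let s' : LTSeries (PrimeSpectrum.zeroLocus (J : Set A)) :=
        { length := s.length
          toFun := fun i => ⟨(s i).1, hs.trans (show s.head ≤ s i from s.head_le i)⟩
          step := fun i => s.step i }
      exact Order.LTSeries.length_le_krullDim s'
    rw [ringKrullDim_quotient]
    refine iSup_le fun s => ?_
    rcases h s.head.1.asIdeal s.head.1.2 s.head.2 with h | h
    · exact (key J s h).trans (le_max_left _ _)
    · exact (key K s h).trans (le_max_right _ _)
  · exact max_le (ringKrullDim_le_of_surjective _ (Ideal.Quotient.factor_surjective hJ))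
      (ringKrullDim_le_of_surjective _ (Ideal.Quotient.factor_surjective hK))

section graded
variable {R₀ : Type*} [CommRing R₀] {A : Type*} [CommRing A] [Algebra R₀ A]
    (𝒜 : ℤ → Submodule R₀ A) [GradedAlgebra 𝒜]
    {M : Type*} [AddCommGroup M] [Module A M] [Module R₀ M] [IsScalarTower R₀ A M]
    (ℳ : ℤ → Submodule R₀ M) [SetLike.GradedSMul 𝒜 ℳ] [DirectSum.Decomposition ℳ]

/-- degree `n` part of `N`, as a submodule of `ℳ n` -/
def part (N : Submodule A M) (n : ℤ) : Submodule R₀ (ℳ n) :=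
  (N.restrictScalars R₀).comap (ℳ n).subtype

noncomputable def HF (N : Submodule A M) (n : ℤ) : ℕ∞ := Module.length R₀ (ℳ n ⧸ part ℳ N n)

lemma mem_part {N : Submodule A M} {n : ℤ} {x : ℳ n} : x ∈ part ℳ N n ↔ (x : M) ∈ N := Iff.rfl

lemma decomp_smul (c : A) {m : M} {d : ℤ} (hm : m ∈ ℳ d) (n : ℤ) :
    (DirectSum.decompose ℳ (c • m) n : M) = (DirectSum.decompose 𝒜 c (n - d) : A) • m := by
  induction c using DirectSum.Decomposition.inductionOn 𝒜 with
  | zero => simp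
  | add a b ha hb => simp [add_smul, DirectSum.decompose_add, ha, hb]
  | @homogeneous i a =>
    have h1 : (a : A) • m ∈ ℳ (i + d) := SetLike.GradedSMul.smul_mem a.2 hm
    by_cases h : n = i + d
    · subst h
      rw [DirectSum.decompose_of_mem_same _ h1, add_sub_cancel_right, DirectSum.decompose_of_mem_same _ a.2]
    · rw [DirectSum.decompose_of_mem_ne _ h1 (Ne.symm h), DirectSum.decompose_of_mem_ne _ a.2 (by omega),
        zero_smul]

def colonI (N : Submodule A M) (m : M) : Ideal A := N.comap (LinearMap.toSpanSingleton A M m)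

lemma mem_colonI {N : Submodule A M} {m : M} {c : A} : c ∈ colonI N m ↔ c • m ∈ N := Iff.rfl

lemma colonI_homog {N : Submodule A M} (hN : N.IsHomogeneous ℳ) {m : M} {d : ℤ} (hm : m ∈ ℳ d) :
    Submodule.IsHomogeneous (colonI N m) 𝒜 := by
  intro i c hc
  have := hN (i + d) (mem_colonI.mp hc)
  rw [decomp_smul 𝒜 ℳ c hm, add_sub_cancel_right] at this
  exact this

include 𝒜 in
lemma sup_homog {N : Submodule A M} (hN : N.IsHomogeneous ℳ) {m : M} {d : ℤ} (hm : m ∈ ℳ d) :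
    (N ⊔ A ∙ m).IsHomogeneous ℳ := by
  intro i y hy
  obtain ⟨u, hu, v, hv, rfl⟩ := Submodule.mem_sup.mp hy
  obtain ⟨c, rfl⟩ := Submodule.mem_span_singleton.mp hv
  rw [DirectSum.decompose_add, DirectSum.add_apply, Submodule.coe_add, decomp_smul 𝒜 ℳ c hm]
  exact Submodule.add_mem_sup (hN i hu) (Submodule.smul_mem _ _ (Submodule.mem_span_singleton_self m))

lemma HF_exact {N : Submodule A M} (hN : N.IsHomogeneous ℳ) {m : M} {d : ℤ} (hm : m ∈ ℳ d) (n : ℤ) :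
    HF ℳ N n = HF 𝒜 (colonI N m) (n - d) + HF ℳ (N ⊔ A ∙ m) n := by
  have hmem : ∀ c : 𝒜 (n - d), (c : A) • m ∈ ℳ n := fun c => by
    have : (c : A) • m ∈ ℳ (n - d + d) := SetLike.GradedSMul.smul_mem c.2 hm
    rwa [sub_add_cancel] at this
  let f₀ : 𝒜 (n - d) →ₗ[R₀] ℳ n :=
    { toFun := fun c => ⟨(c : A) • m, hmem c⟩
      map_add' := fun a b => by ext; simp [add_smul]
      map_smul' := fun r a => by ext; simp }
  have hf₀ : part 𝒜 (colonI N m) (n - d) = (part ℳ N n).comap f₀ := rfl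
  let f := (part 𝒜 (colonI N m) (n - d)).mapQ (part ℳ N n) f₀ hf₀.le
  have hle : part ℳ N n ≤ part ℳ (N ⊔ A ∙ m) n := fun x hx => 
    (le_sup_left : N ≤ N ⊔ A ∙ m) hx
  let g := Submodule.factor hle
  have hf : Function.Injective f := by
    rw [← LinearMap.ker_eq_bot, Submodule.ker_mapQ, ← hf₀]
    exact Submodule.mkQ_map_self _
  refine Module.length_eq_add_of_exact f g hf (Submodule.factor_surjective hle) ?_
  intro y
  obtain ⟨y, rfl⟩ := Submodule.mkQ_surjective _ y
  constructor
  · intro h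
    have h' : (y : M) ∈ N ⊔ A ∙ m :=
      (Submodule.Quotient.mk_eq_zero (part ℳ (N ⊔ A ∙ m) n)).mp h
    obtain ⟨u, hu, v, hv, huv⟩ := Submodule.mem_sup.mp h'
    obtain ⟨c, rfl⟩ := Submodule.mem_span_singleton.mp hv
    refine ⟨Submodule.mkQ _ (DirectSum.decompose 𝒜 c (n - d)), ?_⟩
    change Submodule.Quotient.mk (f₀ _) = Submodule.Quotient.mk y
    rw [eq_comm, Submodule.Quotient.eq, mem_part]
    have h3 : (DirectSum.decompose ℳ (y : M) n : M) = y := DirectSum.decompose_of_mem_same _ y.2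
    rw [← huv, DirectSum.decompose_add, DirectSum.add_apply, Submodule.coe_add, decomp_smul 𝒜 ℳ c hm] at h3
    have h4 := hN n hu
    convert h4 using 1
    change (y : M) - (DirectSum.decompose 𝒜 c (n - d) : A) • m = _
    rw [← huv, ← h3]
    simp
  · rintro ⟨z, hz⟩
    obtain ⟨c, rfl⟩ := Submodule.mkQ_surjective _ z
    rw [← hz]
    change (Submodule.Quotient.mk (f₀ c) : ℳ n ⧸ part ℳ (N ⊔ A ∙ m) n) = 0
    rw [Submodule.Quotient.mk_eq_zero]
    exact (le_sup_right : _ ≤ N ⊔ A ∙ m) (Submodule.smul_mem _ _ (Submodule.mem_span_singleton_self m))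



lemma cast_max_aux (l l' : ℕ) :
    max (l : WithBot ℕ∞) (l' : WithBot ℕ∞) = ((max l l' : ℕ) : WithBot ℕ∞) := by
  rcases le_total l l' with h | h
  · rw [max_eq_right h, max_eq_right (by exact_mod_cast h)]
  · rw [max_eq_left h, max_eq_left (by exact_mod_cast h)]

lemma subsingleton_quot_iff_top {R V : Type*} [Ring R] [AddCommGroup V] [Module R V]
    (p : Submodule R V) : Subsingleton (V ⧸ p) ↔ p = ⊤ := by
  constructor
  · intro h
    rw [eq_top_iff]
    intro x _
    exact (Submodule.Quotient.mk_eq_zero p).mp (Subsingleton.elim _ _)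
  · rintro rfl
    exact ⟨fun a b => by
      obtain ⟨a, rfl⟩ := Submodule.Quotient.mk_surjective _ a
      obtain ⟨b, rfl⟩ := Submodule.Quotient.mk_surjective _ b
      exact (Submodule.Quotient.eq _).mpr trivial⟩

lemma HF_eq_zero_of {N : Submodule A M} {n : ℤ} (h : ∀ x ∈ ℳ n, x ∈ N) : HF ℳ N n = 0 := by
  rw [HF, Module.length_eq_zero_iff, subsingleton_quot_iff_top, eq_top_iff]
  exact fun x _ => h x x.2

lemma ideal_claim [IsArtinianRing R₀] [IsNoetherianRing A] [Algebra.FiniteType R₀ A]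
    (h𝒜 : ∀ i < (0 : ℤ), 𝒜 i = ⊥) (I : Ideal A) (hI : Submodule.IsHomogeneous I 𝒜) (hne : I ≠ ⊤)
    (hfin : ∀ n, HF 𝒜 I n ≠ ⊤) :
    ∃ l : ℕ, ringKrullDim (A ⧸ I) = l ∧ GoodF l (HF 𝒜 I) := by
  induction I using WellFoundedGT.induction with
  | ind I ih =>
  have hneg : ∀ n < 0, HF 𝒜 I n = 0 := fun n hn => HF_eq_zero_of 𝒜 fun x hx => by
    rw [h𝒜 n hn, Submodule.mem_bot] at hx
    rw [hx]; exact I.zero_mem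
  have hz : ∀ i < (0 : ℤ), ∀ y ∈ 𝒜 i, y = 0 := fun i hi y hy => by
    rw [h𝒜 i hi] at hy
    simpa using hy
  have hone : (1 : A) ∉ I := fun h => hne ((Ideal.eq_top_iff_one I).mpr h)
  by_cases hp : I.IsPrime
  · by_cases hx : ∃ s : ℤ, 0 < s ∧ ∃ x ∈ 𝒜 s, x ∉ I
    · obtain ⟨s, hs, x, hxs, hxI⟩ := hx
      have hJh : (I ⊔ A ∙ x).IsHomogeneous 𝒜 := sup_homog 𝒜 𝒜 hI hxs
      have hJne : I ⊔ A ∙ x ≠ ⊤ := by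
        intro h
        have h1 : (1 : A) ∈ I ⊔ A ∙ x := h ▸ Submodule.mem_top
        obtain ⟨u, hu, v, hv, huv⟩ := Submodule.mem_sup.mp h1
        obtain ⟨c, rfl⟩ := Submodule.mem_span_singleton.mp hv
        have h2 : (DirectSum.decompose 𝒜 (1 : A) 0 : A) = 1 :=
          DirectSum.decompose_of_mem_same _ SetLike.GradedOne.one_mem
        have h3 : (DirectSum.decompose 𝒜 c (0 - s) : A) = 0 := by
          exact hz _ (by omega) _ (DirectSum.decompose 𝒜 c (0 - s)).2
        rw [← huv, DirectSum.decompose_add, DirectSum.add_apply, Submodule.coe_add,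
          decomp_smul 𝒜 𝒜 c hxs, h3, zero_smul, add_zero, huv] at h2
        exact hone (h2 ▸ hI 0 hu)
      have hcolon : colonI I x = I := by
        ext c
        rw [mem_colonI, smul_eq_mul]
        exact ⟨fun h => (hp.mem_or_mem h).resolve_right hxI, fun h => I.mul_mem_right _ h⟩
      have hex : ∀ n, HF 𝒜 I n = HF 𝒜 I (n - s) + HF 𝒜 (I ⊔ A ∙ x) n := fun n => by
        have := HF_exact 𝒜 𝒜 hI hxs n
        rwa [hcolon] at this
      have hlt : I < I ⊔ A ∙ x := by
        refine lt_of_le_of_ne le_sup_left fun h => hxI ?_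
        rw [h]
        exact (le_sup_right : _ ≤ I ⊔ A ∙ x) (Submodule.mem_span_singleton_self x)
      obtain ⟨l, hl, hG⟩ := ih _ hlt hJh hJne fun n h => hfin n (by rw [hex, h]; simp)
      refine ⟨l + 1, ?_, ?_⟩
      · rw [← dim_drop R₀ A I x hxI hJne]
        change ringKrullDim (A ⧸ I ⊔ A ∙ x) + 1 = _
        rw [hl]; simp
      · refine hG.succ s.toNat (by omega) hfin hneg fun n => ?_
        rw [hex n, add_comm, Int.toNat_of_nonneg hs.le]
    · push Not at hx
      have h0 : ∀ n, n ≠ 0 → HF 𝒜 I n = 0 := fun n hn => by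
        rcases lt_or_gt_of_ne hn with h | h
        · exact hneg n h
        · exact HF_eq_zero_of 𝒜 (hx n h)
      refine ⟨0, ?_, GoodF.base (hfin 0) ?_ h0⟩
      · let φ : (𝒜 0 ⧸ part 𝒜 I 0) →ₗ[R₀] A ⧸ I :=
          (part 𝒜 I 0).liftQ ((Ideal.Quotient.mkₐ R₀ I).toLinearMap ∘ₗ (𝒜 0).subtype)
            fun x hx => Ideal.Quotient.eq_zero_iff_mem.mpr hx
        have hφ : Function.Surjective φ := by
          intro y
          obtain ⟨a, rfl⟩ := Ideal.Quotient.mk_surjective y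
          refine ⟨Submodule.Quotient.mk (DirectSum.decompose 𝒜 a 0), ?_⟩
          change Ideal.Quotient.mk I ((DirectSum.decompose 𝒜 a 0 : 𝒜 0) : A) = Ideal.Quotient.mk I a
          rw [eq_comm, Ideal.Quotient.eq]
          refine (Submodule.IsHomogeneous.mem_iff 𝒜 hI).mpr fun i => ?_
          rw [DirectSum.decompose_sub, DirectSum.sub_apply, Submodule.coe_sub]
          by_cases hi : i = 0
          · subst hi
            rw [DirectSum.decompose_of_mem_same 𝒜 (DirectSum.decompose 𝒜 a 0).2]
            simp
          · rw [DirectSum.decompose_of_mem_ne 𝒜 (DirectSum.decompose 𝒜 a 0).2 (Ne.symm hi), sub_zero]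
            rcases lt_or_gt_of_ne hi with h | h
            · rw [hz i h _ (DirectSum.decompose 𝒜 a i).2]; exact I.zero_mem
            · exact hx i h _ (DirectSum.decompose 𝒜 a i).2
        have hart : IsArtinian R₀ (𝒜 0 ⧸ part 𝒜 I 0) :=
          (isFiniteLength_iff_isNoetherian_isArtinian.mp (Module.length_ne_top_iff.mp (hfin 0))).2
        have h1 : IsArtinian R₀ (A ⧸ I) := isArtinian_of_surjective _ φ hφ
        have h2 : IsArtinianRing (A ⧸ I) := isArtinian_of_tower R₀ h1
        simpa using ringKrullDim_eq_zero_of_isField (IsArtinianRing.isField_of_isDomain (A ⧸ I))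
      · intro h
        rw [HF, Module.length_eq_zero_iff, subsingleton_quot_iff_top] at h
        have : (⟨1, SetLike.GradedOne.one_mem⟩ : 𝒜 0) ∈ part 𝒜 I 0 := h ▸ Submodule.mem_top
        exact hone this
  · obtain ⟨a, b, ⟨d, ha⟩, hab, haI, hbI⟩ : ∃ a b : A, SetLike.IsHomogeneousElem 𝒜 a ∧
        a * b ∈ I ∧ a ∉ I ∧ b ∉ I := by
      by_contra! hcon
      refine hp (Ideal.IsHomogeneous.isPrime_of_homogeneous_mem_or_mem (𝒜 := 𝒜) hI hne ?_)
      intro x y hx _ hxy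
      by_contra! h
      exact h.2 (hcon x y hx hxy h.1)
    have hex := HF_exact 𝒜 𝒜 hI ha
    have hIJ : I ≤ colonI I a := fun c hc => mem_colonI.mpr (I.mul_mem_right _ hc)
    have hJlt : I < colonI I a := lt_of_le_of_ne hIJ fun h => hbI (by
      rw [h, mem_colonI, smul_eq_mul, mul_comm]; exact hab)
    have haK : a ∈ I ⊔ A ∙ a := (le_sup_right : _ ≤ I ⊔ A ∙ a) (Submodule.mem_span_singleton_self a)
    have hKlt : I < I ⊔ A ∙ a := lt_of_le_of_ne le_sup_left fun h => haI (by rw [h]; exact haK)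
    obtain ⟨l, hl, hG⟩ := ih _ hJlt (colonI_homog 𝒜 𝒜 hI ha)
      (fun h => haI (by simpa [mem_colonI] using ((Ideal.eq_top_iff_one _).mp h)))
      (fun n h => hfin (n + d) (by rw [hex, add_sub_cancel_right, h]; simp))
    obtain ⟨l', hl', hG'⟩ := ih _ hKlt (sup_homog 𝒜 𝒜 hI ha) (fun h => hbI (by
      have h1 : (1 : A) ∈ I ⊔ A ∙ a := h ▸ Submodule.mem_top
      obtain ⟨u, hu, v, hv, huv⟩ := Submodule.mem_sup.mp h1
      obtain ⟨c, rfl⟩ := Submodule.mem_span_singleton.mp hv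
      have : b = u * b + c * (a * b) := by
        rw [smul_eq_mul] at huv
        rw [← mul_assoc, ← add_mul, huv, one_mul]
      rw [this]
      exact I.add_mem (I.mul_mem_right _ hu) (I.mul_mem_left _ hab)))
      (fun n h => hfin n (by rw [hex, h]; simp))
    refine ⟨max l l', ?_, (hG.shift d (fun n => rfl)).add_max hG' hex⟩
    rw [dim_union I (colonI I a) (I ⊔ A ∙ a) hIJ le_sup_left, hl]
    · change max _ (ringKrullDim (A ⧸ I ⊔ A ∙ a)) = _
      rw [hl']
      exact cast_max_aux l l'
    · intro P hP hIP
      by_cases haP : a ∈ P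
      · exact Or.inr (sup_le hIP (by simpa [Submodule.span_le] using haP))
      · exact Or.inl fun c hc => (hP.mem_or_mem (hIP (mem_colonI.mp hc))).resolve_right haP

lemma mem_ann_quot {N : Submodule A M} {c : A} :
    c ∈ Module.annihilator A (M ⧸ N) ↔ ∀ y : M, c • y ∈ N := by
  rw [Module.mem_annihilator]
  constructor
  · intro h y
    exact (Submodule.Quotient.mk_eq_zero N).mp (h (Submodule.Quotient.mk y))
  · intro h y
    obtain ⟨y, rfl⟩ := Submodule.mkQ_surjective _ y
    exact (Submodule.Quotient.mk_eq_zero N).mpr (h y)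

include 𝒜 in
lemma module_claim [IsArtinianRing R₀] [IsNoetherianRing A] [Algebra.FiniteType R₀ A]
    [Module.Finite A M]
    (h𝒜 : ∀ i < (0 : ℤ), 𝒜 i = ⊥) (N : Submodule A M) (hN : N.IsHomogeneous ℳ) (hne : N ≠ ⊤)
    (hfin : ∀ n, HF ℳ N n ≠ ⊤) :
    ∃ l : ℕ, ringKrullDim (A ⧸ Module.annihilator A (M ⧸ N)) = l ∧ GoodF l (HF ℳ N) := by
  induction N using WellFoundedGT.induction with
  | ind N ih =>
  obtain ⟨d, m, hm, hmN⟩ : ∃ d, ∃ m ∈ ℳ d, m ∉ N := by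
    by_contra! h
    refine hne (eq_top_iff.mpr fun x _ => ?_)
    exact (Submodule.IsHomogeneous.mem_iff ℳ hN).mpr fun i => h i _ (DirectSum.decompose ℳ x i).2
  have hex := HF_exact 𝒜 ℳ hN hm
  obtain ⟨l, hl, hG⟩ := ideal_claim 𝒜 h𝒜 (colonI N m) (colonI_homog 𝒜 ℳ hN hm)
      (fun h => hmN (by simpa [mem_colonI] using ((Ideal.eq_top_iff_one _).mp h)))
      (fun n h => hfin (n + d) (by rw [hex, add_sub_cancel_right, h]; simp))
  have hmK : m ∈ N ⊔ A ∙ m := (le_sup_right : _ ≤ N ⊔ A ∙ m) (Submodule.mem_span_singleton_self m)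
  have hKlt : N < N ⊔ A ∙ m := lt_of_le_of_ne le_sup_left fun h => hmN (by rw [h]; exact hmK)
  have hdim := dim_union (Module.annihilator A (M ⧸ N)) (colonI N m)
    (Module.annihilator A (M ⧸ (N ⊔ A ∙ m)))
    (fun c hc => mem_ann_quot.mp hc m)
    (fun c hc => mem_ann_quot.mpr fun y => hKlt.le (mem_ann_quot.mp hc y))
    (by
      intro P hP hle
      by_contra! h
      obtain ⟨i, hi, hiP⟩ := SetLike.not_le_iff_exists.mp h.1
      obtain ⟨k, hk, hkP⟩ := SetLike.not_le_iff_exists.mp h.2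
      have : i * k ∈ P := hle (mem_ann_quot.mpr fun y => by
        obtain ⟨u, hu, v, hv, huv⟩ := Submodule.mem_sup.mp (mem_ann_quot.mp hk y)
        obtain ⟨c, rfl⟩ := Submodule.mem_span_singleton.mp hv
        rw [mul_smul, ← huv, smul_add, smul_comm i c m]
        exact N.add_mem (N.smul_mem _ hu) (N.smul_mem _ (mem_colonI.mp hi)))
      exact (hP.mem_or_mem this).elim hiP hkP)
  by_cases htop : N ⊔ A ∙ m = ⊤
  · refine ⟨l, ?_, hG.shift d fun n => ?_⟩
    · have : Module.annihilator A (M ⧸ (N ⊔ A ∙ m)) = ⊤ := by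
        rw [eq_top_iff]
        intro c _
        rw [mem_ann_quot, htop]
        simp
      have hsub : Subsingleton (A ⧸ Module.annihilator A (M ⧸ (N ⊔ A ∙ m))) :=
        Ideal.Quotient.subsingleton_iff.mpr this
      rw [hdim, hl, ringKrullDim_eq_bot_of_subsingleton]
      simp
    · rw [hex, HF_eq_zero_of ℳ (N := N ⊔ A ∙ m) (fun x _ => by rw [htop]; trivial), add_zero]
  · obtain ⟨l', hl', hG'⟩ := ih _ hKlt (sup_homog 𝒜 ℳ hN hm) htop
      (fun n h => hfin n (by rw [hex, h]; simp))
    refine ⟨max l l', ?_, (hG.shift d (fun n => rfl)).add_max hG' hex⟩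
    rw [hdim, hl, hl']
    exact cast_max_aux l l'

end graded



open Finset

/-- The length of a module, realized as the Krull dimension of its lattice of submodules. -/
noncomputable def moduleLength (R M : Type*) [Semiring R] [AddCommMonoid M] [Module R M] :
    WithBot ℕ∞ :=
  Order.krullDim (Submodule R M)

/-- Let `R₀` be an Artinian local ring and `A = ⊕_{i≥0} A_i` a Noetherian graded
ring finitely generated over `A_0 = R₀`, and let `M` be a nonzero finitely generated graded
`A`-module of (Krull) dimension `l`.  If `P ∈ ℤ((t))` is the Hilbert series of `M`, i.e.
`P = ∑_n λ_{R₀}(M_n) tⁿ`, then there are positive integers `s₁, …, s_l` and a Laurent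
polynomial `p(t) ∈ ℤ[t,t⁻¹]` (a Laurent series with finite support) with `p(1) ≠ 0` such
that `P ⬝ ∏_{i=1}^{l} (1 - t^{sᵢ}) = p(t)`. -/
theorem stmt0 (R₀ : Type*) [CommRing R₀] [IsArtinianRing R₀] [IsLocalRing R₀]
    (A : Type*) [CommRing A] [Algebra R₀ A] [IsNoetherianRing A] [Algebra.FiniteType R₀ A]
    (𝒜 : ℤ → Submodule R₀ A) [GradedAlgebra 𝒜] (h𝒜 : ∀ i < (0 : ℤ), 𝒜 i = ⊥)
    (M : Type*) [AddCommGroup M] [Module A M] [Module R₀ M] [IsScalarTower R₀ A M]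
    [Module.Finite A M] [Nontrivial M]
    (ℳ : ℤ → Submodule R₀ M) [SetLike.GradedSMul 𝒜 ℳ] [DirectSum.Decomposition ℳ]
    (l : ℕ) (hl : ringKrullDim (A ⧸ Module.annihilator A M) = l)
    (ℓ : ℤ → ℕ) (hℓ : ∀ n, moduleLength R₀ (ℳ n) = ((ℓ n : ℕ∞) : WithBot ℕ∞))
    (P : LaurentSeries ℤ) (hP : ∀ n, P.coeff n = (ℓ n : ℤ)) :
    ∃ (s : Fin l → ℕ+) (p : LaurentSeries ℤ),
      p.support.Finite ∧ (∑ᶠ n, p.coeff n) ≠ 0 ∧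
        P * ∏ i, (1 - HahnSeries.single ((s i : ℕ) : ℤ) (1 : ℤ)) = p := by
  have hfin : ∀ n, HF ℳ (⊥ : Submodule A M) n = ℓ n := by
    intro n
    have h1 : part ℳ (⊥ : Submodule A M) n = ⊥ := by
      rw [eq_bot_iff]
      intro x hx
      have hx' : (x : M) = 0 := hx
      exact (Submodule.mem_bot _).mpr (Subtype.ext hx')
    have h2 : Module.length R₀ (ℳ n) = ℓ n := by
      have := hℓ n
      rw [moduleLength, ← Module.coe_length] at this
      exact WithBot.coe_injective this
    rw [HF, (Submodule.quotEquivOfEqBot _ h1).length_eq, h2]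
  obtain ⟨l', hl', P', hP', hG⟩ := module_claim 𝒜 ℳ h𝒜 ⊥ (fun i x hx => by
      have hx' : x = 0 := hx
      simp [hx']) bot_ne_top (fun n => by rw [hfin]; exact ENat.natCast_ne_top _)
  have hann : Module.annihilator A (M ⧸ (⊥ : Submodule A M)) = Module.annihilator A M :=
    (Submodule.quotEquivOfEqBot _ rfl).annihilator_eq
  rw [hann, hl] at hl'
  have hll : l = l' := by exact_mod_cast hl'
  subst hll
  have hPP : P = P' := HS.unique (f := HF ℳ (⊥ : Submodule A M))
    (fun n => ⟨ℓ n, hfin n, hP n⟩) hP'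
  subst hPP
  exact hG.final
end

section
/- Let R be a graded ring of characteristic p > 0 and M a finitely generated graded R-module with λ_R(M) < ∞ and pd_R(M) < ∞. If G_• is a minimal graded free resolution of M with G_i = ⊕_j R(-j)^{b_{ij}}, then the Frobenius pullback F^e(G_•) is a minimal graded free resolution of F^e(M) with i-th term ⊕_j R(-jq)^{b_{ij}}, where q = p^e. Consequently χ_{F^e(M)}^R(t) = χ_M^R(t^q). -/
open Finset

variable (R₀ A : Type*) [CommRing R₀] [CommRing A] [Algebra R₀ A]

/-- The degree-`n` graded piece of the graded free module `⊕_{m} A(-τ m)` (with underlying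
module `Fin r → A`): a vector lies in degree `n` iff its `m`-th coordinate lies in
`𝒜 (n - τ m)`. -/
def freeGrade (𝒜 : ℤ → Submodule R₀ A) {r : ℕ} (τ : Fin r → ℤ) (n : ℤ) :
    Submodule R₀ (Fin r → A) :=
  Submodule.pi Set.univ fun m => 𝒜 (n - τ m)

/-- The graded maximal ideal `𝔪 + A₊` of the graded ring `A` over the (local) coefficient
ring `R₀`. -/
def gradedMaxIdeal [IsLocalRing R₀] (𝒜 : ℤ → Submodule R₀ A) : Ideal A :=
  Ideal.span
    ((algebraMap R₀ A '' (IsLocalRing.maximalIdeal R₀ : Set R₀)) ∪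
      ⋃ (i : ℤ) (_ : 0 < i), (𝒜 i : Set A))

/-- `IsMinimalGradedFreeResolution 𝒜 ℳ r τ D ε N` says that the complex of graded free
`A`-modules `F i = ⊕_{m : Fin (r i)} A(-τ i m)` with differentials `D i : F (i+1) → F i` and
augmentation `ε : F 0 → M` is a minimal graded free resolution of the graded module `(M, ℳ)`
of length at most `N`: all maps are degree-preserving, the complex is exact (a resolution of
`M`), it is finite, and it is minimal (the differentials land in `(𝔪 + A₊)F`, equivalently
the differentials of `F ⊗ K` are all zero). -/
def IsMinimalGradedFreeResolution [IsLocalRing R₀]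
    (𝒜 : ℤ → Submodule R₀ A)
    {M : Type*} [AddCommGroup M] [Module A M] [Module R₀ M] [IsScalarTower R₀ A M]
    (ℳ : ℤ → Submodule R₀ M)
    (r : ℕ → ℕ) (τ : ∀ i, Fin (r i) → ℤ)
    (D : ∀ i : ℕ, ((Fin (r (i + 1)) → A) →ₗ[A] (Fin (r i) → A)))
    (ε : (Fin (r 0) → A) →ₗ[A] M) (N : ℕ) : Prop :=
  (∀ i, N < i → r i = 0) ∧
    Function.Surjective ε ∧
    (∀ n : ℤ, ∀ x ∈ freeGrade R₀ A 𝒜 (τ 0) n, ε x ∈ ℳ n) ∧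
    (∀ i : ℕ, ∀ n : ℤ, ∀ x ∈ freeGrade R₀ A 𝒜 (τ (i + 1)) n,
      D i x ∈ freeGrade R₀ A 𝒜 (τ i) n) ∧
    Function.Exact (D 0) ε ∧
    (∀ i : ℕ, Function.Exact (D (i + 1)) (D i)) ∧
    (∀ i : ℕ, LinearMap.range (D i) ≤
      gradedMaxIdeal R₀ A 𝒜 • (⊤ : Submodule A (Fin (r i) → A)))

section ExtPart
open CategoryTheory CategoryTheory.Abelian

/-- Vanishing of `Ext^l(K, X)`. -/
def ExtVan.{u} {S : Type u} [CommRing S] (K : ModuleCat.{u} S) (l : ℕ) (X : Type u)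
    [AddCommGroup X] [Module S X] : Prop :=
  ∀ α : Ext K (ModuleCat.of S X) l, α = 0

/-- The map induced on `Ext^l(K, -)`. -/
noncomputable def extMap.{u} {S : Type u} [CommRing S] (K : ModuleCat.{u} S) (l : ℕ) {X Y : Type u}
    [AddCommGroup X] [Module S X] [AddCommGroup Y] [Module S Y] (f : X →ₗ[S] Y)
    (α : Ext K (ModuleCat.of S X) l) : Ext K (ModuleCat.of S Y) l :=
  α.comp (Ext.mk₀ (ModuleCat.ofHom f)) (add_zero l)

theorem extMap_comp.{u} {S : Type u} [CommRing S] (K : ModuleCat.{u} S) (l : ℕ) {X Y Z : Type u}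
    [AddCommGroup X] [Module S X] [AddCommGroup Y] [Module S Y] [AddCommGroup Z] [Module S Z]
    (f : X →ₗ[S] Y) (g : Y →ₗ[S] Z) (α : Ext K (ModuleCat.of S X) l) :
    extMap K l (g ∘ₗ f) α = extMap K l g (extMap K l f α) := by
  unfold extMap
  rw [Ext.comp_assoc_of_third_deg_zero, Ext.mk₀_comp_mk₀, ← ModuleCat.ofHom_comp]

theorem extMap_id.{u} {S : Type u} [CommRing S] (K : ModuleCat.{u} S) (l : ℕ) {X : Type u}
    [AddCommGroup X] [Module S X] (α : Ext K (ModuleCat.of S X) l) :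
    extMap K l (LinearMap.id) α = α := by
  unfold extMap
  rw [ModuleCat.ofHom_id, Ext.comp_mk₀_id]

theorem extMap_zero.{u} {S : Type u} [CommRing S] (K : ModuleCat.{u} S) (l : ℕ) {X Y : Type u}
    [AddCommGroup X] [Module S X] [AddCommGroup Y] [Module S Y] (f : X →ₗ[S] Y) :
    extMap K l f 0 = 0 := by
  unfold extMap
  rw [Ext.zero_comp]

theorem extMap_sum.{u} {S : Type u} [CommRing S] (K : ModuleCat.{u} S) (l : ℕ) {X Y : Type u}
    [AddCommGroup X] [Module S X] [AddCommGroup Y] [Module S Y] {ι : Type} [Fintype ι]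
    (f : ι → (X →ₗ[S] Y)) (α : Ext K (ModuleCat.of S X) l) :
    extMap K l (∑ i, f i) α = ∑ i, extMap K l (f i) α := by
  unfold extMap
  rw [← Ext.comp_sum, ← Ext.mk₀_sum]
  congr 2
  ext x
  simp

theorem extMap_smul.{u} {S : Type u} [CommRing S] (K : ModuleCat.{u} S) (l : ℕ) {X Y : Type u}
    [AddCommGroup X] [Module S X] [AddCommGroup Y] [Module S Y] (f : X →ₗ[S] Y) (a : S)
    (ha : ∀ k : K, a • k = 0) (α : Ext K (ModuleCat.of S X) l) :
    extMap K l (a • f) α = 0 := by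
  unfold extMap
  have h1 : ModuleCat.ofHom (a • f) = a • ModuleCat.ofHom f := by
    ext x; simp
  have h2 : a • (𝟙 K) = 0 := by
    ext x
    exact ha x
  rw [h1, Ext.mk₀_smul, Ext.comp_smul, ← Ext.smul_comp]
  have h3 : a • α = 0 := by
    rw [← Ext.mk₀_id_comp α, ← Ext.smul_comp, ← Ext.mk₀_smul, h2, Ext.mk₀_zero, Ext.zero_comp]
  rw [h3, Ext.zero_comp]

theorem ExtVan.retract.{u} {S : Type u} [CommRing S] {K : ModuleCat.{u} S} {l : ℕ} {X Y : Type u}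
    [AddCommGroup X] [Module S X] [AddCommGroup Y] [Module S Y] (f : X →ₗ[S] Y) (g : Y →ₗ[S] X)
    (h : g ∘ₗ f = LinearMap.id) (hY : ExtVan K l Y) : ExtVan K l X := by
  intro α
  rw [← extMap_id K l α, ← h, extMap_comp, hY (extMap K l f α), extMap_zero]

theorem ExtVan.subsingleton.{u} {S : Type u} [CommRing S] (K : ModuleCat.{u} S) (l : ℕ)
    (X : Type u) [AddCommGroup X] [Module S X] [Subsingleton X] : ExtVan K l X := by
  intro α
  have h : (LinearMap.id : X →ₗ[S] X) = ∑ i : Fin 0, (0 : X →ₗ[S] X) := by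
    ext x; exact Subsingleton.elim _ _
  rw [← extMap_id K l α, h, extMap_sum]
  simp

theorem ExtVan.pi.{u} {S : Type u} [CommRing S] {K : ModuleCat.{u} S} {l : ℕ}
    (hS : ExtVan K l S) (r : ℕ) : ExtVan K l (Fin r → S) := by
  intro α
  have h : (LinearMap.id : (Fin r → S) →ₗ[S] (Fin r → S)) =
      ∑ i : Fin r, (LinearMap.single S (fun _ : Fin r => S) i) ∘ₗ (LinearMap.proj i) := by
    refine LinearMap.ext fun x => ?_
    ext j
    simp [Finset.sum_apply, Pi.single_apply]
  rw [← extMap_id K l α, h, extMap_sum]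
  refine Finset.sum_eq_zero fun i _ => ?_
  rw [extMap_comp, hS (extMap K l _ α), extMap_zero]

/-- the short exact sequence of a pair of linear maps -/
theorem shortExact_of_maps.{u} {S : Type u} [CommRing S] {X Y Z : Type u}
    [AddCommGroup X] [Module S X] [AddCommGroup Y] [Module S Y] [AddCommGroup Z] [Module S Z]
    (f : X →ₗ[S] Y) (g : Y →ₗ[S] Z) (hf : Function.Injective f) (hg : Function.Surjective g)
    (hfg : Function.Exact f g) :
    (ShortComplex.mk (ModuleCat.ofHom f) (ModuleCat.ofHom g)
      (by rw [← ModuleCat.ofHom_comp, hfg.linearMap_comp_eq_zero]; rfl)).ShortExact where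
  exact := by
    rw [ShortComplex.ShortExact.moduleCat_exact_iff_function_exact]
    exact hfg
  mono_f := (ModuleCat.mono_iff_injective _).2 hf
  epi_g := (ModuleCat.epi_iff_surjective _).2 hg

theorem ExtVan.third.{u} {S : Type u} [CommRing S] {K : ModuleCat.{u} S} {l : ℕ} {X Y Z : Type u}
    [AddCommGroup X] [Module S X] [AddCommGroup Y] [Module S Y] [AddCommGroup Z] [Module S Z]
    (f : X →ₗ[S] Y) (g : Y →ₗ[S] Z) (hf : Function.Injective f) (hg : Function.Surjective g)
    (hfg : Function.Exact f g) (hY : ExtVan K l Y) (hX : ExtVan K (l + 1) X) :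
    ExtVan K l Z := by
  intro α
  have hs := shortExact_of_maps f g hf hg hfg
  obtain ⟨β, rfl⟩ := Ext.covariant_sequence_exact₃ K hs α rfl (hX _)
  rw [hY β, Ext.zero_comp]

/-- injectivity on `Ext^{l+1}` -/
theorem ExtVan.inj_succ.{u} {S : Type u} [CommRing S] {K : ModuleCat.{u} S} {l : ℕ}
    {X Y Z : Type u}
    [AddCommGroup X] [Module S X] [AddCommGroup Y] [Module S Y] [AddCommGroup Z] [Module S Z]
    (f : X →ₗ[S] Y) (g : Y →ₗ[S] Z) (hf : Function.Injective f) (hg : Function.Surjective g)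
    (hfg : Function.Exact f g) (hZ : ExtVan K l Z) (α : Ext K (ModuleCat.of S X) (l + 1))
    (hα : extMap K (l + 1) f α = 0) : α = 0 := by
  have hs := shortExact_of_maps f g hf hg hfg
  obtain ⟨β, rfl⟩ := Ext.covariant_sequence_exact₁ K hs α hα rfl
  rw [hZ β, Ext.zero_comp]

theorem ExtVan.inj_zero.{u} {S : Type u} [CommRing S] {K : ModuleCat.{u} S}
    {X Y : Type u}
    [AddCommGroup X] [Module S X] [AddCommGroup Y] [Module S Y]
    (f : X →ₗ[S] Y) (hf : Function.Injective f) (α : Ext K (ModuleCat.of S X) 0)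
    (hα : extMap K 0 f α = 0) : α = 0 := by
  have : Mono (ModuleCat.ofHom f) := (ModuleCat.mono_iff_injective _).2 hf
  refine Ext.postcomp_mk₀_injective_of_mono K (ModuleCat.ofHom f) ?_
  rw [map_zero]
  exact hα

theorem ExtVan.hom_eq_zero.{u} {S : Type u} [CommRing S] {K : Type u} [AddCommGroup K] [Module S K]
    {X : Type u} [AddCommGroup X] [Module S X] (h : ExtVan (ModuleCat.of S K) 0 X)
    (f : K →ₗ[S] X) : f = 0 := by
  have h1 := h (Ext.mk₀ (ModuleCat.ofHom f))
  rw [Ext.mk₀_eq_zero_iff] at h1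
  have := congrArg ModuleCat.Hom.hom h1
  simpa using this

end ExtPart
theorem extVan_of_resolution.{u} {S : Type u} [CommRing S] (K : ModuleCat.{u} S)
    (r : ℕ → ℕ) (D : ∀ i : ℕ, ((Fin (r (i + 1)) → S) →ₗ[S] (Fin (r i) → S))) (N : ℕ)
    (h1 : r (N + 1) ≠ 0) (h2 : r (N + 1 + 1) = 0)
    (hex : ∀ i : ℕ, Function.Exact (D (i + 1)) (D i))
    (hK : ∀ j i (k : K), (D N (Pi.single j 1) i) • k = 0) :
    ∀ l, l < N + 1 → ExtVan K l S := by
  intro l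
  induction l using Nat.strong_induction_on with
  | _ l ih =>
  intro hl
  have ih' : ∀ m < l, ExtVan K m S := by
    intro m hm
    exact ih m hm (by omega)
  have hexr : ∀ j, Function.Exact (LinearMap.range (D (j + 1))).subtype (D j).rangeRestrict := by
    intro j x
    rw [Subtype.ext_iff]
    simp only [LinearMap.codRestrict_apply, LinearMap.rangeRestrict, ZeroMemClass.coe_zero]
    rw [hex j x]
    simp
  have claim1 : ∀ a j, a < l → a ≤ j → ExtVan K a (LinearMap.range (D j)) := by
    intro a
    induction a with
    | zero =>
      intro j hal _ α
      refine ExtVan.inj_zero (LinearMap.range (D j)).subtype (Submodule.injective_subtype _) α ?_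
      exact (ExtVan.pi (ih' 0 hal) _) _
    | succ a iha =>
      intro j hal haj α
      obtain ⟨j, rfl⟩ : ∃ j', j = j' + 1 := ⟨j - 1, by omega⟩
      refine ExtVan.inj_succ (LinearMap.range (D (j + 1))).subtype (D j).rangeRestrict
        (Submodule.injective_subtype _) (LinearMap.surjective_rangeRestrict _) (hexr j)
        (iha j (by omega) (by omega)) α ?_
      exact (ExtVan.pi (ih' (a + 1) hal) _) _
  have claim2 : ∀ α : CategoryTheory.Abelian.Ext K (ModuleCat.of S (LinearMap.range (D N))) l,
      extMap K l (LinearMap.range (D N)).subtype α = 0 → α = 0 := by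
    intro α hα
    rcases l with _ | l
    · exact ExtVan.inj_zero _ (Submodule.injective_subtype _) α hα
    · obtain ⟨N, rfl⟩ : ∃ N', N = N' + 1 := ⟨N - 1, by omega⟩
      exact ExtVan.inj_succ (LinearMap.range (D (N + 1))).subtype (D N).rangeRestrict
        (Submodule.injective_subtype _) (LinearMap.surjective_rangeRestrict _) (hexr N)
        (claim1 l N (by omega) (by omega)) α hα
  have hinj : Function.Injective (D N) := by
    rw [← LinearMap.ker_eq_bot, eq_bot_iff]
    intro x hx
    obtain ⟨y, rfl⟩ := (hex N x).1 hx
    have : IsEmpty (Fin (r (N + 1 + 1))) := by rw [h2]; infer_instance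
    rw [Subsingleton.elim y 0]
    simp
  have hzero : ∀ α : CategoryTheory.Abelian.Ext K (ModuleCat.of S (Fin (r (N + 1)) → S)) l,
      extMap K l (D N) α = 0 := by
    intro α
    have h : D N = ∑ ij : Fin (r (N + 1)) × Fin (r N), (D N (Pi.single ij.1 1) ij.2) •
        ((LinearMap.single S (fun _ : Fin (r N) => S) ij.2) ∘ₗ
          (LinearMap.proj (φ := fun _ : Fin (r (N + 1)) => S) ij.1)) := by
      refine LinearMap.pi_ext' fun j => LinearMap.ext_ring ?_
      ext i
      simp [Finset.sum_apply, Pi.single_apply, Fintype.sum_prod_type]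
    rw [h, extMap_sum]
    refine Finset.sum_eq_zero fun ij _ => ?_
    exact extMap_smul K l _ _ (hK _ _) α
  have hvan : ExtVan K l (Fin (r (N + 1)) → S) := by
    intro α
    have h3 : extMap K l (D N).rangeRestrict α = 0 := by
      refine claim2 _ ?_
      rw [← extMap_comp]
      exact hzero α
    have h4 : ((LinearEquiv.ofInjective (D N) hinj).symm : _ →ₗ[S] _) ∘ₗ (D N).rangeRestrict =
        LinearMap.id := by
      refine LinearMap.ext fun x => ?_
      exact (LinearEquiv.ofInjective (D N) hinj).symm_apply_apply x
    rw [← extMap_id K l α, ← h4, extMap_comp, h3, extMap_zero]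
  have j0 : Fin (r (N + 1)) := ⟨0, Nat.pos_of_ne_zero h1⟩
  refine ExtVan.retract (LinearMap.single S (fun _ : Fin (r (N + 1)) => S) j0)
    (LinearMap.proj j0) ?_ hvan
  refine LinearMap.ext_ring ?_
  simp

theorem acyclic_of_extVan.{u} {S : Type u} [CommRing S] [IsNoetherianRing S]
    (r : ℕ → ℕ) (D : ∀ i : ℕ, ((Fin (r (i + 1)) → S) →ₗ[S] (Fin (r i) → S))) (T : ℕ)
    (hr : ∀ i, T < i → r i = 0)
    (hcomp : ∀ i : ℕ, ∀ z, D i (D (i + 1) z) = 0)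
    (hH : ∀ Q : Ideal S, Q.IsPrime →
      (∃ i z, D i z = 0 ∧ z ∉ LinearMap.range (D (i + 1)) ∧
        ∀ a, a • z ∈ LinearMap.range (D (i + 1)) → a ∈ Q) →
      ∀ l < T, ExtVan (ModuleCat.of S (S ⧸ Q)) l S) :
    ∀ i : ℕ, Function.Exact (D (i + 1)) (D i) := by
  have hsub : ∀ i, T ≤ i → Subsingleton (Fin (r (i + 1)) → S) := by
    intro i hi
    have : IsEmpty (Fin (r (i + 1))) := by rw [hr (i + 1) (by omega)]; infer_instance
    infer_instance
  suffices H : ∀ n i, T ≤ i + n → Function.Exact (D (i + 1)) (D i) by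
    intro i; exact H T i (by omega)
  intro n
  induction n with
  | zero =>
    intro i hi x
    have := hsub i (by omega)
    rw [Subsingleton.elim x 0]
    simp only [map_zero, Set.mem_range, true_iff]
    exact ⟨0, map_zero _⟩
  | succ n ih =>
    intro i hi
    by_cases hiT : T ≤ i
    · exact ih i (by omega)
    have hexr : ∀ j, i < j →
        Function.Exact (LinearMap.range (D (j + 1))).subtype (D j).rangeRestrict := by
      intro j hj x
      rw [Subtype.ext_iff]
      simp only [LinearMap.codRestrict_apply, LinearMap.rangeRestrict, ZeroMemClass.coe_zero]
      rw [ih j (by omega) x]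
      simp
    have hle : LinearMap.range (D (i + 1)) ≤ LinearMap.ker (D i) := by
      rintro _ ⟨z, rfl⟩
      exact hcomp i z
    by_contra hne
    let B := (LinearMap.range (D (i + 1))).submoduleOf (LinearMap.ker (D i))
    have hnt : Nontrivial (LinearMap.ker (D i) ⧸ B) := by
      by_contra hnt
      rw [not_nontrivial_iff_subsingleton, Submodule.Quotient.subsingleton_iff] at hnt
      apply hne
      intro x
      constructor
      · intro hx
        have : (⟨x, hx⟩ : LinearMap.ker (D i)) ∈ B := by rw [hnt]; trivial
        exact this
      · intro hx
        exact hle hx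
    obtain ⟨Q, hQ⟩ := associatedPrimes.nonempty S (LinearMap.ker (D i) ⧸ B)
    have hQ' : IsAssociatedPrime Q (LinearMap.ker (D i) ⧸ B) := hQ
    rw [isAssociatedPrime_iff_exists_injective_linearMap] at hQ'
    obtain ⟨hQp, f, hf⟩ := hQ'
    obtain ⟨z, hz⟩ := Submodule.mkQ_surjective B (f 1)
    have hzQ : ∀ a : S, a • (z : Fin (r (i + 1)) → S) ∈ LinearMap.range (D (i + 1)) ↔ a ∈ Q := by
      intro a
      have e1 : a • (z : Fin (r (i + 1)) → S) ∈ LinearMap.range (D (i + 1)) ↔ a • z ∈ B :=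
        Iff.rfl
      rw [e1, ← Submodule.Quotient.mk_eq_zero, ← Submodule.mkQ_apply, map_smul, hz, ← map_smul,
        map_eq_zero_iff f hf, ← Ideal.Quotient.eq_zero_iff_mem, Algebra.smul_def, mul_one]
      rfl
    have hE : ∀ l < T, ExtVan (ModuleCat.of S (S ⧸ Q)) l S := by
      refine hH Q hQp ⟨i, z, z.2, ?_, fun a ha => (hzQ a).1 ha⟩
      intro h
      have := (hzQ 1).1 (by simpa using h)
      exact hQp.ne_top ((Ideal.eq_top_iff_one _).2 this)
    have hrange : ∀ m j, T ≤ j + m → i < j → ∀ l, l < j + 1 →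
        ExtVan (ModuleCat.of S (S ⧸ Q)) l (LinearMap.range (D j)) := by
      intro m
      have htriv : ∀ j l, T ≤ j →
          ExtVan (ModuleCat.of S (S ⧸ Q)) l (LinearMap.range (D j)) := by
        intro j l hj
        have := hsub j hj
        have : Subsingleton (LinearMap.range (D j)) :=
          (LinearMap.surjective_rangeRestrict (D j)).subsingleton
        exact ExtVan.subsingleton _ _ _
      induction m with
      | zero => intro j hj _ l _; exact htriv j l (by omega)
      | succ m ihm =>
        intro j hj hij l hl
        by_cases hjT : T ≤ j
        · exact htriv j l hjT
        refine ExtVan.third (LinearMap.range (D (j + 1))).subtype (D j).rangeRestrict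
          (Submodule.injective_subtype _) (LinearMap.surjective_rangeRestrict _) (hexr j hij)
          (ExtVan.pi (hE l (by omega)) _) (ihm (j + 1) (by omega) (by omega) (l + 1) (by omega))
    have hY : ExtVan (ModuleCat.of S (S ⧸ Q)) 0 (LinearMap.ker (D i)) := by
      intro α
      refine ExtVan.inj_zero (LinearMap.ker (D i)).subtype (Submodule.injective_subtype _) α ?_
      exact (ExtVan.pi (hE 0 (by omega)) _) _
    have hHv : ExtVan (ModuleCat.of S (S ⧸ Q)) 0 (LinearMap.ker (D i) ⧸ B) := by
      refine ExtVan.third (Submodule.inclusion hle) B.mkQ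
        (Submodule.inclusion_injective _) (Submodule.mkQ_surjective _) ?_ hY
        (hrange T (i + 1) (by omega) (by omega) 1 (by omega))
      intro x
      rw [Submodule.mkQ_apply, Submodule.Quotient.mk_eq_zero]
      constructor
      · intro hx
        exact ⟨⟨x, hx⟩, rfl⟩
      · rintro ⟨y, rfl⟩
        exact y.2
    have hf0 := hHv.hom_eq_zero f
    have h1 : (1 : S ⧸ Q) = 0 := hf (by rw [hf0]; simp)
    have : (1 : S) ∈ Q := by
      rw [← Ideal.Quotient.eq_zero_iff_mem, map_one, h1]
    exact hQp.ne_top ((Ideal.eq_top_iff_one _).2 this)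

theorem exists_lift_pi {S : Type*} [CommRing S] {a : ℕ} {X Y : Type*} [AddCommGroup X] [Module S X]
    [AddCommGroup Y] [Module S Y] (f : X →ₗ[S] Y) (g : (Fin a → S) →ₗ[S] Y)
    (h : ∀ z, g z ∈ Set.range f) : ∃ s : (Fin a → S) →ₗ[S] X, f ∘ₗ s = g := by
  choose w hw using fun j : Fin a => h (Pi.single j 1)
  refine ⟨(Pi.basisFun S (Fin a)).constr S w, ?_⟩
  refine (Pi.basisFun S (Fin a)).ext fun j => ?_
  rw [LinearMap.comp_apply, Module.Basis.constr_basis, hw, Pi.basisFun_apply]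

theorem exists_homotopy {S : Type*} [CommRing S] {M : Type*} [AddCommGroup M] [Module S M]
    (r : ℕ → ℕ) (D : ∀ i : ℕ, ((Fin (r (i + 1)) → S) →ₗ[S] (Fin (r i) → S)))
    (ε : (Fin (r 0) → S) →ₗ[S] M)
    (h0 : Function.Exact (D 0) ε)
    (hex : ∀ i : ℕ, Function.Exact (D (i + 1)) (D i)) (x : S) (hx : ∀ m : M, x • m = 0) (i : ℕ) :
    ∃ (t : (Fin (r (i + 1)) → S) →ₗ[S] (Fin (r (i + 1 + 1)) → S))
      (s : (Fin (r i) → S) →ₗ[S] (Fin (r (i + 1)) → S)),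
      D (i + 1) ∘ₗ t + s ∘ₗ D i = x • LinearMap.id := by
  have step : ∀ i, ∀ s : (Fin (r i) → S) →ₗ[S] (Fin (r (i + 1)) → S),
      (∀ z, D i (s (D i z)) = x • D i z) →
      ∃ (t : (Fin (r (i + 1)) → S) →ₗ[S] (Fin (r (i + 1 + 1)) → S)),
      D (i + 1) ∘ₗ t + s ∘ₗ D i = x • LinearMap.id := by
    intro i s hs
    obtain ⟨t, ht⟩ := exists_lift_pi (D (i + 1)) (x • LinearMap.id - s ∘ₗ D i) (by
      intro z
      rw [← (hex i) _]
      simp [hs])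
    exact ⟨t, by rw [ht]; simp⟩
  have key : ∀ i, ∃ s : (Fin (r i) → S) →ₗ[S] (Fin (r (i + 1)) → S),
      ∀ z, D i (s (D i z)) = x • D i z := by
    intro i
    induction i with
    | zero =>
      obtain ⟨s, hs⟩ := exists_lift_pi (D 0) (x • LinearMap.id) (by
        intro z
        rw [← h0 _]
        simp [hx])
      exact ⟨s, fun z => by simpa using LinearMap.congr_fun hs (D 0 z)⟩
    | succ i ih =>
      obtain ⟨s, hs⟩ := ih
      obtain ⟨t, ht⟩ := step i s hs
      refine ⟨t, fun z => ?_⟩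
      have := LinearMap.congr_fun ht (D (i + 1) z)
      have h3 : D i (D (i + 1) z) = 0 := (hex i).apply_apply_eq_zero z
      simpa [h3] using this
  obtain ⟨s, hs⟩ := key i
  obtain ⟨t, ht⟩ := step i s hs
  exact ⟨t, s, ht⟩

/-- Base change of a linear map of free modules along a ring endomorphism. -/
noncomputable def frobMap {S : Type*} [CommRing S] (φ : S →+* S) {a b : ℕ}
    (f : (Fin a → S) →ₗ[S] (Fin b → S)) : (Fin a → S) →ₗ[S] (Fin b → S) :=
  Matrix.toLin' ((LinearMap.toMatrix' f).map φ)

theorem frobMap_comp {S : Type*} [CommRing S] (φ : S →+* S) {a b c : ℕ}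
    (f : (Fin a → S) →ₗ[S] (Fin b → S)) (g : (Fin b → S) →ₗ[S] (Fin c → S)) :
    frobMap φ (g ∘ₗ f) = frobMap φ g ∘ₗ frobMap φ f := by
  unfold frobMap
  rw [LinearMap.toMatrix'_comp, Matrix.map_mul, Matrix.toLin'_mul]

theorem frobMap_add {S : Type*} [CommRing S] (φ : S →+* S) {a b : ℕ}
    (f g : (Fin a → S) →ₗ[S] (Fin b → S)) :
    frobMap φ (f + g) = frobMap φ f + frobMap φ g := by
  unfold frobMap
  rw [map_add, Matrix.map_add _ (map_add φ), map_add]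

theorem frobMap_zero {S : Type*} [CommRing S] (φ : S →+* S) {a b : ℕ} :
    frobMap φ (0 : (Fin a → S) →ₗ[S] (Fin b → S)) = 0 := by
  unfold frobMap
  rw [map_zero, Matrix.map_zero _ (map_zero φ), map_zero]

theorem frobMap_smul_id {S : Type*} [CommRing S] (φ : S →+* S) {a : ℕ} (x : S) :
    frobMap φ (x • (LinearMap.id : (Fin a → S) →ₗ[S] (Fin a → S))) = φ x • LinearMap.id := by
  unfold frobMap
  rw [map_smul, LinearMap.toMatrix'_id, Matrix.map_smul' φ _ _ (map_mul φ), Matrix.map_one _ (map_zero φ) (map_one φ),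
    map_smul, Matrix.toLin'_one]

theorem frobMap_single {S : Type*} [CommRing S] (φ : S →+* S) {a b : ℕ}
    (f : (Fin a → S) →ₗ[S] (Fin b → S)) (j : Fin a) :
    frobMap φ f (Pi.single j 1) = fun i => φ (f (Pi.single j 1) i) := by
  unfold frobMap
  ext i
  simp [Matrix.toLin'_apply, LinearMap.toMatrix'_apply]

/-- The Peskine-Szpiro type exactness statement. -/
theorem frob_exact.{u, v} {S : Type u} [CommRing S] [IsNoetherianRing S]
    {M : Type v} [AddCommGroup M] [Module S M]
    (φ : S →+* S) (q : ℕ) (hφ : ∀ x, φ x = x ^ q)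
    (r : ℕ → ℕ) (D : ∀ i : ℕ, ((Fin (r (i + 1)) → S) →ₗ[S] (Fin (r i) → S)))
    (ε : (Fin (r 0) → S) →ₗ[S] M) (N : ℕ) (hN : ∀ i, N < i → r i = 0)
    (h0 : Function.Exact (D 0) ε)
    (hex : ∀ i : ℕ, Function.Exact (D (i + 1)) (D i))
    (hent : ∀ i j k, D i (Pi.single j 1) k ∈ (Module.annihilator S M).radical) :
    ∀ i : ℕ, Function.Exact (frobMap φ (D (i + 1))) (frobMap φ (D i)) := by
  obtain ⟨T, hT1, hT2⟩ : ∃ T, (∀ i, T < i → r i = 0) ∧ (T = 0 ∨ r T ≠ 0) := by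
    clear hex h0 hent D ε
    induction N with
    | zero => exact ⟨0, hN, Or.inl rfl⟩
    | succ N ih =>
      by_cases h : r (N + 1) = 0
      · refine ih fun i hi => ?_
        rcases Nat.lt_or_ge (N + 1) i with h' | h'
        · exact hN i h'
        · obtain rfl : i = N + 1 := by omega
          exact h
      · exact ⟨N + 1, hN, Or.inr h⟩
  refine acyclic_of_extVan r (fun i => frobMap φ (D i)) T hT1 ?_ ?_
  · intro i z
    have : D i ∘ₗ D (i + 1) = 0 := (hex i).linearMap_comp_eq_zero
    rw [← LinearMap.comp_apply, ← frobMap_comp, this, frobMap_zero, LinearMap.zero_apply]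
  · rintro Q hQ ⟨i, z, hz, -, hzQ⟩ l hl
    have hann : Module.annihilator S M ≤ Q := by
      intro x hx
      rw [Module.mem_annihilator] at hx
      obtain ⟨t, s, hts⟩ := exists_homotopy r D ε h0 hex x hx i
      have h1 := congrArg (frobMap φ) hts
      rw [frobMap_add, frobMap_comp, frobMap_comp, frobMap_smul_id] at h1
      have h2 := LinearMap.congr_fun h1 z
      simp only [LinearMap.add_apply, LinearMap.comp_apply, hz, map_zero, add_zero,
        LinearMap.smul_apply, LinearMap.id_apply] at h2
      have h3 := hzQ (φ x) ⟨_, h2⟩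
      rw [hφ] at h3
      exact hQ.mem_of_pow_mem _ h3
    rcases hT2 with rfl | hT2
    · omega
    obtain ⟨T, rfl⟩ : ∃ T', T = T' + 1 := ⟨T - 1, by omega⟩
    refine extVan_of_resolution _ r D T hT2 (hT1 _ (by omega)) hex ?_ l hl
    intro j k c
    have hmem : D T (Pi.single j 1) k ∈ Q := by
      have := Ideal.radical_mono hann (hent T j k)
      rwa [hQ.radical] at this
    obtain ⟨c, rfl⟩ := Ideal.Quotient.mk_surjective (I := Q) c
    change Ideal.Quotient.mk Q (D T (Pi.single j 1) k * c) = 0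
    rw [Ideal.Quotient.eq_zero_iff_mem]
    exact Q.mul_mem_right _ hmem

theorem mem_smul_top_pi {S : Type*} [CommRing S] (I : Ideal S) {a : ℕ} (z : Fin a → S) :
    z ∈ I • (⊤ : Submodule S (Fin a → S)) ↔ ∀ k, z k ∈ I := by
  constructor
  · intro hz k
    refine Submodule.smul_induction_on hz ?_ ?_
    · intro x hx w _
      exact I.mul_mem_right _ hx
    · intro x y hx hy
      exact I.add_mem hx hy
  · intro h
    rw [← Finset.univ_sum_single z]
    refine Submodule.sum_mem _ fun k _ => ?_
    have : (Pi.single k (z k) : Fin a → S) = z k • (Pi.single k 1 : Fin a → S) := by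
      rw [← Pi.single_smul, smul_eq_mul, mul_one]
    rw [this]
    exact Submodule.smul_mem_smul (h k) trivial

theorem linearMap_pi_apply {S : Type*} [CommRing S] {a b : ℕ}
    (f : (Fin a → S) →ₗ[S] (Fin b → S)) (z : Fin a → S) (k : Fin b) :
    f z k = ∑ j, z j * f (Pi.single j 1) k := by
  conv_lhs => rw [LinearMap.pi_apply_eq_sum_univ f z]
  rw [Finset.sum_apply]
  refine Finset.sum_congr rfl fun j _ => ?_
  rw [Pi.smul_apply, smul_eq_mul]
  have : (fun i => if j = i then (1 : S) else 0) = Pi.single j 1 := by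
    ext i
    simp [Pi.single_apply, eq_comm]
  rw [this]

theorem single_mem_freeGrade {R₁ S : Type*} [CommRing R₁] [CommRing S] [Algebra R₁ S]
    (𝒜 : ℤ → Submodule R₁ S) [GradedAlgebra 𝒜] {a : ℕ} (τ : Fin a → ℤ) (j : Fin a) :
    (Pi.single j 1 : Fin a → S) ∈ freeGrade R₁ S 𝒜 τ (τ j) := by
  unfold freeGrade
  rw [Submodule.mem_pi]
  intro k _
  by_cases h : k = j
  · subst h
    simpa using SetLike.GradedOne.one_mem (A := 𝒜)
  · rw [Pi.single_eq_of_ne h]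
    exact Submodule.zero_mem _

theorem decompose_smul_of_mem {R₁ S : Type*} [CommRing R₁] [CommRing S] [Algebra R₁ S]
    (𝒜 : ℤ → Submodule R₁ S)
    {M : Type*} [AddCommGroup M] [Module S M] [Module R₁ M]
    (ℳ : ℤ → Submodule R₁ M) [SetLike.GradedSMul 𝒜 ℳ] [DirectSum.Decomposition ℳ]
    {i : ℤ} {x : S} (hx : x ∈ 𝒜 i) (w : M) (n : ℤ) :
    (DirectSum.decompose ℳ (x • w) n : M) = x • (DirectSum.decompose ℳ w (n - i) : M) := by
  induction w using DirectSum.Decomposition.inductionOn ℳ with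
  | zero => simp
  | @homogeneous j m =>
    have h : x • (m : M) ∈ ℳ (i + j) := SetLike.GradedSMul.smul_mem hx m.2
    by_cases hn : n = i + j
    · subst hn
      rw [DirectSum.decompose_of_mem_same ℳ h, add_sub_cancel_left,
        DirectSum.decompose_of_mem_same ℳ m.2]
    · rw [DirectSum.decompose_of_mem_ne ℳ h (Ne.symm hn),
        DirectSum.decompose_of_mem_ne ℳ m.2 (by omega), smul_zero]
  | add a b ha hb =>
    simp only [smul_add, DirectSum.decompose_add, DirectSum.add_apply, Submodule.coe_add, ha, hb]

theorem gradedMaxIdeal_le_radical {R₁ S : Type*} [CommRing R₁] [IsArtinianRing R₁] [IsLocalRing R₁]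
    [CommRing S] [Algebra R₁ S]
    (𝒜 : ℤ → Submodule R₁ S) [GradedAlgebra 𝒜] (h𝒜 : ∀ i < (0 : ℤ), 𝒜 i = ⊥)
    {M : Type*} [AddCommGroup M] [Module S M] [Module R₁ M] [IsScalarTower R₁ S M]
    [IsArtinian S M]
    (ℳ : ℤ → Submodule R₁ M) [SetLike.GradedSMul 𝒜 ℳ] [DirectSum.Decomposition ℳ]
    {a : ℕ} (τ : Fin a → ℤ) (ε : (Fin a → S) →ₗ[S] M) (hε : Function.Surjective ε)
    (hdeg : ∀ n : ℤ, ∀ x ∈ freeGrade R₁ S 𝒜 τ n, ε x ∈ ℳ n) :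
    gradedMaxIdeal R₁ S 𝒜 ≤ (Module.annihilator S M).radical := by
  unfold gradedMaxIdeal
  rw [Ideal.span_le]
  rintro x (⟨y, hy, rfl⟩ | hx)
  · have hnil : IsNilpotent y := by
      obtain ⟨n, hn⟩ := IsArtinianRing.isNilpotent_jacobson_bot (R := R₁)
      refine ⟨n, ?_⟩
      have h1 : y ∈ Ideal.jacobson (⊥ : Ideal R₁) := by
        rw [IsLocalRing.jacobson_eq_maximalIdeal _ bot_ne_top]
        exact hy
      have := Ideal.pow_mem_pow h1 n
      rw [hn] at this
      simpa using this
    obtain ⟨n, hn⟩ := hnil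
    refine ⟨n, ?_⟩
    rw [← map_pow, hn, map_zero]
    exact Ideal.zero_mem _
  · simp only [Set.mem_iUnion] at hx
    obtain ⟨i, hi, hx⟩ := hx
    -- degrees of `M` are bounded below
    obtain ⟨n0, hn0⟩ : ∃ n0 : ℤ, ∀ j, n0 ≤ τ j := by
      obtain ⟨n0, h⟩ := (Set.finite_range τ).bddBelow
      exact ⟨n0, fun j => h ⟨j, rfl⟩⟩
    have hlow : ∀ (w : M) (n : ℤ), n < n0 → (DirectSum.decompose ℳ w n : M) = 0 := by
      intro w n hn
      obtain ⟨z, rfl⟩ := hε w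
      have hz : ε z = ∑ j, z j • ε (Pi.single j 1) := by
        conv_lhs => rw [LinearMap.pi_apply_eq_sum_univ ε z]
        refine Finset.sum_congr rfl fun j _ => ?_
        congr 2
        ext i
        simp [Pi.single_apply, eq_comm]
      rw [hz, DirectSum.decompose_sum, DFinsupp.finsetSum_apply, AddSubmonoidClass.coe_finsetSum]
      refine Finset.sum_eq_zero fun j _ => ?_
      have hej := hdeg _ _ (single_mem_freeGrade 𝒜 τ j)
      generalize ε (Pi.single j 1) = v at hej
      generalize z j = c
      induction c using DirectSum.Decomposition.inductionOn 𝒜 with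
      | zero => simp
      | @homogeneous k c =>
        rw [decompose_smul_of_mem 𝒜 ℳ c.2]
        by_cases hk : k < 0
        · have : (c : S) = 0 := by
            have h : ∀ y ∈ 𝒜 k, y = 0 := by
              rw [h𝒜 k hk]
              intro y hy
              simpa using hy
            exact h _ c.2
          rw [this, zero_smul]
        · rw [DirectSum.decompose_of_mem_ne ℳ hej (by have := hn0 j; omega), smul_zero]
      | add c d hc hd =>
        simp only [add_smul, DirectSum.decompose_add, DirectSum.add_apply, Submodule.coe_add, hc,
          hd, add_zero]
    obtain ⟨n, hn⟩ := IsArtinian.monotone_stabilizes (R := S) (M := M)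
      ⟨fun k => OrderDual.toDual (LinearMap.range ((LinearMap.lsmul S M x) ^ k)), by
        intro k l hkl
        obtain ⟨c, rfl⟩ := Nat.exists_eq_add_of_le hkl
        change LinearMap.range ((LinearMap.lsmul S M x) ^ (k + c)) ≤
          LinearMap.range ((LinearMap.lsmul S M x) ^ k)
        rw [pow_add]
        exact LinearMap.range_comp_le_range _ _⟩
    have hpow : ∀ k (w : M), ((LinearMap.lsmul S M x) ^ k) w = x ^ k • w := by
      intro k w
      induction k generalizing w with
      | zero => simp
      | succ k ih =>
        rw [pow_succ, Module.End.mul_apply, ih, LinearMap.lsmul_apply, smul_smul, pow_succ]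
    refine ⟨n, ?_⟩
    rw [Module.mem_annihilator]
    intro m
    apply (DirectSum.decompose ℳ).injective
    rw [DirectSum.decompose_zero]
    refine DFinsupp.ext fun d => ?_
    obtain ⟨k, hk⟩ : ∃ k : ℕ, d - n0 < k := ⟨(d - n0).toNat + 1, by omega⟩
    have hmem : x ^ n • m ∈ LinearMap.range ((LinearMap.lsmul S M x) ^ (n + k)) := by
      have h1 : LinearMap.range ((LinearMap.lsmul S M x) ^ n) =
        LinearMap.range ((LinearMap.lsmul S M x) ^ (n + k)) := hn (n + k) (by omega)
      rw [← h1, ← hpow]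
      exact ⟨m, rfl⟩
    obtain ⟨w, hw⟩ := hmem
    rw [hpow] at hw
    have hxk : x ^ (n + k) ∈ 𝒜 ((n + k) • i) := SetLike.pow_mem_graded _ hx
    apply Subtype.ext
    rw [← hw, decompose_smul_of_mem 𝒜 ℳ hxk, hlow, smul_zero]
    · rfl
    · have : ((n + k : ℕ) : ℤ) ≤ (n + k : ℕ) * i := by nlinarith
      rw [nsmul_eq_mul]
      push_cast at *
      omega

theorem hahn_coeff (N : ℕ) (r : ℕ → ℕ) (τ : ∀ i, Fin (r i) → ℤ) (n : ℤ) :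
    (∑ i ∈ Finset.range (N + 1),
            ((-1 : ℤ) ^ i) •
              ∑ m : Fin (r i), HahnSeries.single (τ i m) (1 : ℤ)).coeff n =
    ∑ i ∈ Finset.range (N + 1), ((-1 : ℤ) ^ i) * ∑ m : Fin (r i), if n = τ i m then 1 else 0 := by
  rw [HahnSeries.coeff_sum]
  refine Finset.sum_congr rfl fun i _ => ?_
  rw [HahnSeries.coeff_smul, HahnSeries.coeff_sum, smul_eq_mul]
  congr 1
  refine Finset.sum_congr rfl fun m _ => ?_
  rw [HahnSeries.coeff_single]
  congr

/-- Let `A` be a graded ring of prime characteristic `p` (Noetherian, finitely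
generated over an Artinian local ring `R₀`) and `M` a finitely generated graded `A`-module
with `λ_A(M) < ∞` and `pd_A(M) < ∞`.  Let `G_•` be a minimal graded free resolution of `M`
with `G i = ⊕_j A(-j)^(b i j)` (ranks `r i`, twists `τ i`), and let `q = p^e`.  The
Frobenius pullback `F^e(G_•)` is the complex with the same free modules whose differentials
`D'` have matrix entries the `q`-th powers of those of `D`; `F^e(M)` is presented as a
module `M'` with `F 0 ↠ M'` and kernel `im (D' 0)` (Frobenius base change is right exact).
Then `F^e(G_•)` is a minimal graded free resolution of `F^e(M)` with `i`-th term
`⊕_j A(-jq)^(b i j)` (twists `q ⬝ τ i m`), and consequently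
`χ_{F^e(M)}(t) = χ_M(t^q)`, where `χ(t) = ∑_i (-1)^i ∑_m t^(τ i m)`. -/
theorem stmt9 {R₀ A : Type*} [CommRing R₀] [IsArtinianRing R₀] [IsLocalRing R₀]
    [CommRing A] [Algebra R₀ A] [IsNoetherianRing A] [Algebra.FiniteType R₀ A]
    (p : ℕ) (hp : p.Prime) [CharP A p] (e : ℕ)
    (𝒜 : ℤ → Submodule R₀ A) [GradedAlgebra 𝒜] (h𝒜 : ∀ i < (0 : ℤ), 𝒜 i = ⊥)
    (M : Type*) [AddCommGroup M] [Module A M] [Module R₀ M] [IsScalarTower R₀ A M]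
    [Module.Finite A M]
    (ℳ : ℤ → Submodule R₀ M) [SetLike.GradedSMul 𝒜 ℳ] [DirectSum.Decomposition ℳ]
    (L : ℕ) (hL : moduleLength A M = ((L : ℕ∞) : WithBot ℕ∞))
    (r : ℕ → ℕ) (τ : ∀ i, Fin (r i) → ℤ)
    (D : ∀ i : ℕ, ((Fin (r (i + 1)) → A) →ₗ[A] (Fin (r i) → A)))
    (ε : (Fin (r 0) → A) →ₗ[A] M) (N : ℕ)
    (hres : IsMinimalGradedFreeResolution R₀ A 𝒜 ℳ r τ D ε N)
    -- the Frobenius pullback complex: same free modules, matrix entries raised to the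
    -- `q = p^e`-th power
    (D' : ∀ i : ℕ, ((Fin (r (i + 1)) → A) →ₗ[A] (Fin (r i) → A)))
    (hD' : ∀ (i : ℕ) (m' : Fin (r (i + 1))),
      D' i (Pi.single m' (1 : A)) = fun m => (D i (Pi.single m' (1 : A)) m) ^ p ^ e)
    -- `M' = F^e(M)`, presented as the cokernel of `F^e(D 0)` (Frobenius is right exact),
    -- with its induced grading `ℳ'`
    (M' : Type*) [AddCommGroup M'] [Module A M'] [Module R₀ M'] [IsScalarTower R₀ A M']
    (ε' : (Fin (r 0) → A) →ₗ[A] M') (hε' : Function.Surjective ε')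
    (hker : LinearMap.ker ε' = LinearMap.range (D' 0))
    (ℳ' : ℤ → Submodule R₀ M')
    (hℳ' : ∀ n : ℤ, ℳ' n =
      Submodule.map (LinearMap.restrictScalars R₀ ε')
        (freeGrade R₀ A 𝒜 (fun m => (p ^ e : ℤ) * τ 0 m) n)) :
    IsMinimalGradedFreeResolution R₀ A 𝒜 ℳ' r (fun i m => (p ^ e : ℤ) * τ i m) D' ε' N ∧
      (∀ k : ℤ,
        (∑ i ∈ Finset.range (N + 1),
            ((-1 : ℤ) ^ i) •
              ∑ m : Fin (r i), HahnSeries.single ((p ^ e : ℤ) * τ i m) (1 : ℤ)).coeff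
            ((p ^ e : ℤ) * k) =
          (∑ i ∈ Finset.range (N + 1),
              ((-1 : ℤ) ^ i) • ∑ m : Fin (r i), HahnSeries.single (τ i m) (1 : ℤ)).coeff k) ∧
      ∀ n : ℤ, (∀ k : ℤ, n ≠ (p ^ e : ℤ) * k) →
        (∑ i ∈ Finset.range (N + 1),
            ((-1 : ℤ) ^ i) •
              ∑ m : Fin (r i), HahnSeries.single ((p ^ e : ℤ) * τ i m) (1 : ℤ)).coeff n = 0 := by
  obtain ⟨hr, hεs, hεd, hDd, hex0, hex, hmin⟩ := hres
  have hq : (p ^ e : ℤ) ≠ 0 := pow_ne_zero _ (by exact_mod_cast hp.ne_zero)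
  have hq' : p ^ e ≠ 0 := pow_ne_zero _ hp.ne_zero
  have : Fact p.Prime := ⟨hp⟩
  have : ExpChar A p := ExpChar.prime hp
  have hart : IsArtinian A M := by
    have h1 : Module.length A M ≠ ⊤ := by
      intro h
      have h2 := Module.coe_length A M
      unfold moduleLength at hL
      rw [hL, h] at h2
      exact absurd (WithBot.coe_injective h2) (ENat.top_ne_coe L)
    rw [Module.length_ne_top_iff, isFiniteLength_iff_isNoetherian_isArtinian] at h1
    exact h1.2
  have hrad := gradedMaxIdeal_le_radical 𝒜 h𝒜 ℳ (τ 0) ε hεs hεd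
  have hent : ∀ i j k, D i (Pi.single j 1) k ∈ gradedMaxIdeal R₀ A 𝒜 := fun i j k =>
    (mem_smul_top_pi _ _).1 (hmin i ⟨_, rfl⟩) k
  have hfrob := frob_exact (iterateFrobenius A p e) (p ^ e)
    (fun x => iterateFrobenius_def p e x) r D ε N hr hex0 hex
    (fun i j k => hrad (hent i j k))
  have hDD : ∀ i, D' i = frobMap (iterateFrobenius A p e) (D i) := by
    intro i
    refine LinearMap.pi_ext' fun j => LinearMap.ext_ring ?_
    change D' i (Pi.single j 1) = frobMap (iterateFrobenius A p e) (D i) (Pi.single j 1)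
    rw [hD', frobMap_single]
    ext k
    rw [iterateFrobenius_def]
  refine ⟨⟨hr, hε', ?_, ?_, ?_, ?_, ?_⟩, ?_, ?_⟩
  · intro n x hx
    rw [hℳ']
    exact ⟨x, hx, rfl⟩
  · intro i n x hx
    unfold freeGrade at hx ⊢
    rw [Submodule.mem_pi] at hx ⊢
    intro k _
    rw [linearMap_pi_apply]
    refine Submodule.sum_mem _ fun j _ => ?_
    rw [hD']
    have h1 := hDd i _ _ (single_mem_freeGrade 𝒜 (τ (i + 1)) j)
    unfold freeGrade at h1
    rw [Submodule.mem_pi] at h1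
    have h2 := SetLike.mul_mem_graded (hx j trivial) (SetLike.pow_mem_graded (p ^ e) (h1 k trivial))
    convert h2 using 2
    rw [nsmul_eq_mul]
    push_cast
    ring
  · intro x
    rw [← LinearMap.mem_ker, hker]
    rfl
  · intro i
    rw [hDD, hDD]
    exact hfrob i
  · rintro i _ ⟨x, rfl⟩
    rw [mem_smul_top_pi]
    intro k
    rw [linearMap_pi_apply]
    refine Ideal.sum_mem _ fun j _ => Ideal.mul_mem_left _ _ ?_
    rw [hD']
    exact Ideal.pow_mem_of_mem _ (hent i j k) _ (Nat.pos_of_ne_zero hq')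
  · intro k
    rw [hahn_coeff N r (fun i m => (p ^ e : ℤ) * τ i m), hahn_coeff N r τ]
    simp only [mul_right_inj' hq]
  · intro n hn
    rw [hahn_coeff N r (fun i m => (p ^ e : ℤ) * τ i m)]
    simp [hn]
end

section
/- Let R be a Noetherian ring of prime characteristic p, M a finitely generated R-module of finite projective dimension, and G_• a finite free resolution of M. Then the complex F^e(G_•) obtained by applying the Frobenius functor is acyclic and is a free resolution of F^e(M), for every e ≥ 0. -/
open TensorProduct

/-- `FrobTwist R p e` is the ring `R` viewed as an `R`-algebra via the `e`-th iterate of the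
Frobenius endomorphism `r ↦ r^(p^e)`.  Base change along this algebra structure is the
Peskine–Szpiro Frobenius functor `F^e`. -/
def FrobTwist (R : Type*) (_p _e : ℕ) : Type _ := R

instance FrobTwist.instCommRing (R : Type*) [CommRing R] (p e : ℕ) :
    CommRing (FrobTwist R p e) := ‹CommRing R›

noncomputable instance FrobTwist.instAlgebra (R : Type*) [CommRing R] (p e : ℕ)
    [ExpChar R p] : Algebra R (FrobTwist R p e) :=
  (iterateFrobenius R p e).toAlgebra

namespace PS

/-- The `q`-th power map as a ring endomorphism, when it is additive. -/
def powHom (A : Type*) [CommRing A] (q : ℕ) (hq : q ≠ 0)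
    (h : ∀ x y : A, (x + y) ^ q = x ^ q + y ^ q) : A →+* A where
  toFun x := x ^ q
  map_one' := one_pow q
  map_mul' x y := mul_pow x y q
  map_zero' := zero_pow hq
  map_add' := h

/-- Exactness in positive degrees of a bounded complex of matrices. -/
structure FC {A : Type*} [CommRing A] (r : ℕ → ℕ)
    (D : ∀ i : ℕ, Matrix (Fin (r i)) (Fin (r (i + 1))) A) : Prop where
  bdd : ∃ N, ∀ i, N ≤ i → r i = 0
  comp : ∀ i, D i * D (i + 1) = 0
  ex : ∀ i v, (D i).mulVec v = 0 → ∃ w, (D (i + 1)).mulVec w = v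

theorem FC.shift {A : Type*} [CommRing A] {r : ℕ → ℕ}
    {D : ∀ i : ℕ, Matrix (Fin (r i)) (Fin (r (i + 1))) A} (h : FC r D) (k : ℕ) :
    FC (fun i => r (k + i)) (fun i => D (k + i)) where
  bdd := by
    obtain ⟨N, hN⟩ := h.bdd
    exact ⟨N, fun i hi => hN _ (by omega)⟩
  comp i := h.comp (k + i)
  ex i := h.ex (k + i)

/-- Over a local ring of depth zero, injective matrices split. -/
theorem split_of_inj {A : Type*} [CommRing A] [IsLocalRing A] (z : A) (hz : z ≠ 0)
    (hm : ∀ x ∈ IsLocalRing.maximalIdeal A, x * z = 0)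
    {m n : Type*} [Fintype m] [Fintype n] [DecidableEq m] [DecidableEq n] (B : Matrix m n A)
    (hB : ∀ v, B.mulVec v = 0 → v = 0) : ∃ L : Matrix n m A, L * B = 1 := by
  classical
  let π := IsLocalRing.residue A
  have hinj : Function.Injective (Matrix.toLin' (B.map π)) := by
    rw [injective_iff_map_eq_zero]
    intro v hv
    obtain ⟨u, rfl⟩ : ∃ u : n → A, (fun i => π (u i)) = v := by
      choose u hu using fun i => IsLocalRing.residue_surjective (v i)
      exact ⟨u, funext hu⟩
    have h1 : ∀ i, (B.mulVec u) i ∈ IsLocalRing.maximalIdeal A := by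
      intro i
      rw [← IsLocalRing.residue_eq_zero_iff]
      have := congrFun hv i
      simp only [Matrix.toLin'_apply, Matrix.mulVec, dotProduct, Matrix.map_apply,
        Pi.zero_apply] at this
      simpa [Matrix.mulVec, dotProduct, map_sum, π] using this
    have h2 : B.mulVec (z • u) = 0 := by
      rw [Matrix.mulVec_smul]
      ext i
      have := hm _ (h1 i)
      simpa [mul_comm] using this
    have h3 := hB _ h2
    ext i
    have h4 : z * u i = 0 := congrFun h3 i
    by_contra hne
    have hu : IsUnit (u i) := by
      by_contra hnu
      exact hne ((IsLocalRing.residue_eq_zero_iff _).2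
        ((IsLocalRing.mem_maximalIdeal _).2 hnu))
    exact hz (hu.mul_left_eq_zero.1 h4)
  obtain ⟨g, hg⟩ := LinearMap.exists_leftInverse_of_injective _ (LinearMap.ker_eq_bot.2 hinj)
  obtain ⟨L, hL⟩ : ∃ L : Matrix n m A, L.map π = LinearMap.toMatrix' g := by
    choose L hL using fun i j => IsLocalRing.residue_surjective (LinearMap.toMatrix' g i j)
    exact ⟨Matrix.of L, by ext i j; exact hL i j⟩
  have h5 : (L * B).map π = 1 := by
    rw [Matrix.map_mul, hL]
    have := congrArg LinearMap.toMatrix' hg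
    rwa [LinearMap.toMatrix'_comp, LinearMap.toMatrix'_toLin', LinearMap.toMatrix'_id] at this
  have h6 : IsUnit (L * B).det := by
    have : π (L * B).det = 1 := by
      rw [RingHom.map_det]
      simp only [RingHom.mapMatrix_apply]
      rw [h5, Matrix.det_one]
    by_contra hnu
    have h7 := (IsLocalRing.residue_eq_zero_iff _).2 ((IsLocalRing.mem_maximalIdeal _).2 hnu)
    exact one_ne_zero (this.symm.trans h7)
  refine ⟨(L * B)⁻¹ * L, ?_⟩
  rw [Matrix.mul_assoc, Matrix.nonsing_inv_mul _ h6]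

theorem FC.homotopy {A : Type*} [CommRing A] [IsLocalRing A] (z : A) (hz : z ≠ 0)
    (hm : ∀ x ∈ IsLocalRing.maximalIdeal A, x * z = 0) {r : ℕ → ℕ}
    {D : ∀ i : ℕ, Matrix (Fin (r i)) (Fin (r (i + 1))) A} (h : FC r D) (i : ℕ) :
    ∃ (s : Matrix (Fin (r (i + 1))) (Fin (r i)) A)
      (t : Matrix (Fin (r (i + 1 + 1))) (Fin (r (i + 1))) A), s * D i + D (i + 1) * t = 1 := by
  obtain ⟨N, hN⟩ := h.bdd
  suffices H : ∀ k i, N ≤ i + 1 + k → ∃ (s : Matrix (Fin (r (i + 1))) (Fin (r i)) A)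
      (t : Matrix (Fin (r (i + 1 + 1))) (Fin (r (i + 1))) A), s * D i + D (i + 1) * t = 1 from
    H N i (by omega)
  intro k
  induction k with
  | zero =>
    intro i hi
    refine ⟨0, 0, ?_⟩
    ext a
    have := hN (i + 1) hi
    exact (Fin.cast this a).elim0
  | succ k ih =>
    intro i hi
    obtain ⟨s, t, hst⟩ := ih (i + 1) (by omega)
    obtain ⟨L, hL⟩ := split_of_inj z hz hm (Matrix.fromRows (D i) (D (i + 1) * s)) (by
      intro v hv
      rw [Matrix.fromRows_mulVec] at hv
      have h1 : (D i).mulVec v = 0 := by ext a; exact congrFun hv (Sum.inl a)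
      have h2 : (D (i + 1) * s).mulVec v = 0 := by ext a; exact congrFun hv (Sum.inr a)
      obtain ⟨w, rfl⟩ := h.ex i v h1
      have h3 : D (i + 1) * s * D (i + 1) = D (i + 1) := by
        have := congrArg (D (i + 1) * ·) hst
        simp only [Matrix.mul_add, ← Matrix.mul_assoc, h.comp (i + 1), Matrix.zero_mul,
          Matrix.mul_one, add_zero] at this
        exact this
      rwa [Matrix.mulVec_mulVec, h3] at h2)
    refine ⟨L.toCols₁, s, ?_⟩
    rw [← Matrix.fromCols_toCols L, Matrix.fromCols_mul_fromRows] at hL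
    have h3 : D (i + 1) * s * D (i + 1) = D (i + 1) := by
      have := congrArg (D (i + 1) * ·) hst
      simp only [Matrix.mul_add, ← Matrix.mul_assoc, h.comp (i + 1), Matrix.zero_mul,
        Matrix.mul_one, add_zero] at this
      exact this
    have h4 := congrArg (· * (1 - D (i + 1) * s)) hL
    have h5 : D i * (1 - D (i + 1) * s) = D i := by
      rw [Matrix.mul_sub, ← Matrix.mul_assoc, h.comp i]; simp
    have h6 : D (i + 1) * s * (1 - D (i + 1) * s) = 0 := by
      rw [Matrix.mul_sub, ← Matrix.mul_assoc, h3]; simp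
    simp only [Matrix.add_mul, Matrix.mul_assoc L.toCols₁, Matrix.mul_assoc L.toCols₂, h5, h6,
      Matrix.one_mul, Matrix.mul_zero, add_zero] at h4
    rw [h4]; simp

theorem FC.exact_depth_zero {A : Type*} [CommRing A] [IsLocalRing A] (z : A) (hz : z ≠ 0)
    (hm : ∀ x ∈ IsLocalRing.maximalIdeal A, x * z = 0) {r : ℕ → ℕ}
    {D : ∀ i : ℕ, Matrix (Fin (r i)) (Fin (r (i + 1))) A} (h : FC r D) (F : A →+* A)
    (v) (hv : ((D 0).map F).mulVec v = 0) : ∃ w, ((D 1).map F).mulVec w = v := by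
  obtain ⟨s, t, hst⟩ := h.homotopy z hz hm 0
  have := congrArg (fun M => M.map F) hst
  rw [Matrix.map_add _ (map_add F), Matrix.map_mul, Matrix.map_mul,
    Matrix.map_one _ (map_zero F) (map_one F)] at this
  have h2 := congrArg (fun M => M.mulVec v) this
  simp only [Matrix.add_mulVec, ← Matrix.mulVec_mulVec, hv, Matrix.mulVec_zero, zero_add,
    Matrix.one_mulVec] at h2
  exact ⟨_, h2⟩

theorem map_mulVec' {A B : Type*} [CommRing A] [CommRing B] (f : A →+* B) {m n : Type*}
    [Fintype n] (M : Matrix m n A) (v : n → A) :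
    (M.map f).mulVec (fun i => f (v i)) = fun i => f (M.mulVec v i) := by
  ext i
  simp [Matrix.mulVec, dotProduct, map_sum]

/-- Localization of an exact complex. -/
theorem FC.localize {A B : Type*} [CommRing A] [CommRing B] [Algebra A B] (S : Submonoid A)
    [IsLocalization S B] {r : ℕ → ℕ}
    {D : ∀ i : ℕ, Matrix (Fin (r i)) (Fin (r (i + 1))) A} (h : FC r D) :
    FC r (fun i => (D i).map (algebraMap A B)) where
  bdd := h.bdd
  comp i := by
    rw [← Matrix.map_mul, h.comp i]; ext; simp
  ex i v hv := by
    obtain ⟨b, hb⟩ := IsLocalization.exist_integer_multiples_of_finite S v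
    choose u hu using hb
    have h1 : (fun j => algebraMap A B ((D i).mulVec u j)) = 0 := by
      rw [← map_mulVec']
      have : (fun j => algebraMap A B (u j)) = algebraMap A B b • v := by
        ext j; rw [hu]; simp [Algebra.smul_def]
      rw [this, Matrix.mulVec_smul, hv, smul_zero]
    have h2 : ∀ j, ∃ c : S, (c : A) * (D i).mulVec u j = 0 := fun j =>
      (IsLocalization.map_eq_zero_iff S B _).1 (congrFun h1 j)
    choose c hc using h2
    have h3 : (D i).mulVec ((∏ j, (c j : A)) • u) = 0 := by
      rw [Matrix.mulVec_smul]
      ext j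
      obtain ⟨d, hd⟩ := Finset.dvd_prod_of_mem (fun j => (c j : A)) (Finset.mem_univ j)
      simp only [Pi.smul_apply, smul_eq_mul, Pi.zero_apply]
      rw [hd, mul_right_comm, hc, zero_mul]
    obtain ⟨w, hw⟩ := h.ex i _ h3
    let e : S := (∏ j, c j) * b
    have he : algebraMap A B e = algebraMap A B (∏ j, (c j : A)) * algebraMap A B b := by
      simp [e]
    obtain ⟨g, hg⟩ := (IsLocalization.map_units B e).exists_left_inv
    refine ⟨g • fun j => algebraMap A B (w j), ?_⟩
    rw [Matrix.mulVec_smul, map_mulVec', hw]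
    ext j
    simp only [Pi.smul_apply, smul_eq_mul, map_mul]
    rw [hu, Algebra.smul_def, ← mul_assoc (algebraMap A B _) _ (v j), ← he, ← mul_assoc, hg,
      one_mul]

/-- Reduction modulo a regular element. -/
theorem FC.quot {A : Type*} [CommRing A] (x : A) (hx : ∀ y, x * y = 0 → y = 0) {r : ℕ → ℕ}
    {D : ∀ i : ℕ, Matrix (Fin (r i)) (Fin (r (i + 1))) A} (h : FC r D) :
    FC (fun i => r (1 + i))
      (fun i => (D (1 + i)).map (Ideal.Quotient.mk (Ideal.span {x}))) := by
  have key : ∀ i v, ((D (i + 1)).map (Ideal.Quotient.mk (Ideal.span {x}))).mulVec v = 0 →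
      ∃ w, ((D (i + 1 + 1)).map (Ideal.Quotient.mk (Ideal.span {x}))).mulVec w = v := by
    intro i v hv
    obtain ⟨u, rfl⟩ : ∃ u : _ → A, (fun i => Ideal.Quotient.mk (Ideal.span {x}) (u i)) = v := by
      choose u hu using fun i => Ideal.Quotient.mk_surjective (v i)
      exact ⟨u, funext hu⟩
    rw [map_mulVec'] at hv
    have h1 : ∀ j, ∃ c, (D (i + 1)).mulVec u j = x * c := fun j =>
      Ideal.mem_span_singleton.1 (Ideal.Quotient.eq_zero_iff_mem.1 (congrFun hv j))
    choose c hc using h1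
    have hc' : (D (i + 1)).mulVec u = x • c := funext hc
    have h2 : (D i).mulVec c = 0 := by
      ext j
      apply hx
      have : (D i).mulVec (x • c) = 0 := by
        rw [← hc', Matrix.mulVec_mulVec, h.comp, Matrix.zero_mulVec]
      rw [Matrix.mulVec_smul] at this
      exact congrFun this j
    obtain ⟨d, hd⟩ := h.ex i c h2
    obtain ⟨w, hw⟩ := h.ex (i + 1) (u - x • d) (by
      rw [Matrix.mulVec_sub, Matrix.mulVec_smul, hd, hc', sub_self])
    refine ⟨fun j => Ideal.Quotient.mk _ (w j), ?_⟩
    rw [map_mulVec', hw]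
    ext j
    simp only [Pi.sub_apply, Pi.smul_apply, smul_eq_mul, map_sub, map_mul]
    rw [Ideal.Quotient.eq_zero_iff_mem.2 (Ideal.mem_span_singleton_self x)]
    simp
  constructor
  · exact (h.shift 1).bdd
  · intro i
    have h1 := (h.shift 1).comp i
    rw [← Matrix.map_mul, h1]; ext; simp
  · intro i
    have := key i
    rw [add_comm i 1] at this
    exact this

theorem map_powHom {A B : Type*} [CommRing A] [CommRing B] (f : A →+* B) (q : ℕ) (hq : q ≠ 0)
    (hA : ∀ x y : A, (x + y) ^ q = x ^ q + y ^ q) (hB : ∀ x y : B, (x + y) ^ q = x ^ q + y ^ q)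
    {m n : Type*} (M : Matrix m n A) :
    (M.map f).map (powHom B q hq hB) = (M.map (powHom A q hq hA)).map f := by
  ext i j
  simp [powHom]

/-- Peskine–Szpiro in degree one, by Noetherian induction over quotients of `R`. -/
theorem main {R : Type*} [CommRing R] [IsNoetherianRing R] (q : ℕ) (hq : q ≠ 0) (I : Ideal R) :
    ∀ (A : Type _) [CommRing A] (f : R →+* A), Function.Surjective f → RingHom.ker f = I →
    ∀ (hA : ∀ x y : A, (x + y) ^ q = x ^ q + y ^ q) (r : ℕ → ℕ)
    (D : ∀ i : ℕ, Matrix (Fin (r i)) (Fin (r (i + 1))) A), FC r D →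
    ∀ v, ((D 0).map (powHom A q hq hA)).mulVec v = 0 →
      ∃ w, ((D 1).map (powHom A q hq hA)).mulVec w = v := by
  induction I using IsNoetherian.induction with
  | _ I ih =>
  intro A _ f hf hI hA r D h v hv
  rcases subsingleton_or_nontrivial A with hs | hnt
  · exact ⟨0, Subsingleton.elim _ _⟩
  have : IsNoetherianRing A := isNoetherianRing_of_surjective R A f hf
  let J : Ideal A :=
    (LinearMap.range (((D 1).map (powHom A q hq hA)).mulVecLin)).comap
      (LinearMap.toSpanSingleton A _ v)
  have hJ : ∀ s, s ∈ J ↔ ∃ w, ((D 1).map (powHom A q hq hA)).mulVec w = s • v := by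
    intro s; simp [J]
  by_cases hreg : ∃ x ∈ J, ∀ y, x * y = 0 → y = 0
  · obtain ⟨x, hxJ, hx⟩ := hreg
    obtain ⟨u, hu⟩ := (hJ x).1 hxJ
    let g := Ideal.Quotient.mk (Ideal.span {x})
    have hx0 : x ≠ 0 := by
      rintro rfl
      exact one_ne_zero (hx 1 (by simp))
    have hB : ∀ a b : A ⧸ Ideal.span {x}, (a + b) ^ q = a ^ q + b ^ q := by
      intro a b
      obtain ⟨a, rfl⟩ := Ideal.Quotient.mk_surjective a
      obtain ⟨b, rfl⟩ := Ideal.Quotient.mk_surjective b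
      simp only [← map_add, ← map_pow, hA]
    have hlt : RingHom.ker (g.comp f) > I := by
      rw [gt_iff_lt, ← hI]
      refine lt_of_le_of_ne ?_ ?_
      · intro a ha
        rw [RingHom.mem_ker] at ha ⊢
        simp [ha]
      · intro heq
        obtain ⟨y, rfl⟩ := hf x
        have : y ∈ RingHom.ker (g.comp f) := by
          rw [RingHom.mem_ker]
          exact Ideal.Quotient.eq_zero_iff_mem.2 (Ideal.mem_span_singleton_self _)
        rw [← heq] at this
        exact hx0 this
    obtain ⟨t, ht⟩ := ih _ hlt (A ⧸ Ideal.span {x}) (g.comp f)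
      (Ideal.Quotient.mk_surjective.comp hf) rfl hB _ _ (h.quot x hx)
      (fun i => g (u i)) (by
        rw [map_powHom _ q hq hA hB]
        change (((D 1).map (powHom A q hq hA)).map g).mulVec _ = 0
        rw [map_mulVec', hu]
        ext j
        apply Ideal.Quotient.eq_zero_iff_mem.2
        exact Ideal.mul_mem_right _ _ (Ideal.mem_span_singleton_self x))
    rw [map_powHom _ q hq hA hB] at ht
    obtain ⟨t, rfl⟩ : ∃ t' : _ → A, (fun i => g (t' i)) = t := by
      choose u hu using fun i => Ideal.Quotient.mk_surjective (t i)
      exact ⟨u, funext hu⟩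
    change (((D 2).map (powHom A q hq hA)).map g).mulVec _ = _ at ht
    rw [map_mulVec'] at ht
    have h1 : ∀ j, ∃ c, u j - ((D 2).map (powHom A q hq hA)).mulVec t j = x * c := fun j =>
      Ideal.mem_span_singleton.1 (Ideal.Quotient.eq.1 (congrFun ht j).symm)
    choose c hc using h1
    refine ⟨c, ?_⟩
    have h2 : x • ((D 1).map (powHom A q hq hA)).mulVec c = x • v := by
      rw [← hu, ← Matrix.mulVec_smul]
      have : x • c = u - ((D 2).map (powHom A q hq hA)).mulVec t := by
        ext j; exact (hc j).symm
      rw [this, Matrix.mulVec_sub, Matrix.mulVec_mulVec, ← Matrix.map_mul, h.comp 1]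
      simp [Matrix.map_zero]
    ext j
    have h3 := congrFun h2 j
    simp only [Pi.smul_apply, smul_eq_mul] at h3
    exact sub_eq_zero.1 (hx _ (by rw [mul_sub, h3, sub_self]))
  · exfalso
    push Not at hreg
    obtain ⟨P, hPass, hJP⟩ : ∃ P ∈ associatedPrimes A A, J ≤ P := by
      have hfin := associatedPrimes.finite A A
      have hsub : (J : Set A) ⊆ ⋃ P ∈ hfin.toFinset, ((id P : Ideal A) : Set A) := by
        intro x hxJ
        obtain ⟨y, hy, hy0⟩ := hreg x hxJ
        have : x ∈ ⋃ p ∈ associatedPrimes A A, (p : Set A) := by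
          rw [biUnion_associatedPrimes_eq_zero_divisors]
          exact ⟨y, hy0, hy⟩
        simpa using this
      obtain ⟨P, hP, hle⟩ := (Ideal.subset_union_prime (f := id) ⊥ ⊥ (by
        intro i hi _ _
        exact (hfin.mem_toFinset.1 hi).isPrime)).1 hsub
      exact ⟨P, hfin.mem_toFinset.1 hP, hle⟩
    rw [AssociatedPrimes.mem_iff, isAssociatedPrime_iff] at hPass
    obtain ⟨hPprime, z, hz⟩ := hPass
    have hz' : ∀ a, a ∈ P ↔ a * z = 0 := by
      intro a
      rw [hz, Submodule.mem_colon_singleton]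
      simp
    let B := Localization.AtPrime P
    have hB : ∀ a b : B, (a + b) ^ q = a ^ q + b ^ q := by
      intro a b
      obtain ⟨a, s, rfl⟩ := IsLocalization.exists_mk'_eq P.primeCompl a
      obtain ⟨b, t, rfl⟩ := IsLocalization.exists_mk'_eq P.primeCompl b
      rw [← IsLocalization.mk'_add, ← IsLocalization.mk'_pow, ← IsLocalization.mk'_pow,
        ← IsLocalization.mk'_pow, ← IsLocalization.mk'_add, hA]
      congr 1
      · simp only [mul_pow, SubmonoidClass.coe_pow]
      · rw [mul_pow]
    have hzB : algebraMap A B z ≠ 0 := by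
      intro h0
      obtain ⟨c, hc⟩ := (IsLocalization.map_eq_zero_iff P.primeCompl B z).1 h0
      exact c.2 ((hz' _).2 hc)
    have hmB : ∀ x ∈ IsLocalRing.maximalIdeal B, x * algebraMap A B z = 0 := by
      intro x hx
      obtain ⟨a, s, rfl⟩ := IsLocalization.exists_mk'_eq P.primeCompl x
      have ha : a ∈ P := (IsLocalization.AtPrime.mk'_mem_maximal_iff B P a s).1 hx
      rw [mul_comm, ← IsLocalization.mk'_one (M := P.primeCompl) B z, ← IsLocalization.mk'_mul,
        mul_comm z a, (hz' a).1 ha, IsLocalization.mk'_zero]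
    obtain ⟨w, hw⟩ := (h.localize (B := B) P.primeCompl).exact_depth_zero _ hzB hmB
      (powHom B q hq hB) (fun i => algebraMap A B (v i)) (by
        rw [map_powHom _ q hq hA hB, map_mulVec', hv]; ext; simp)
    rw [map_powHom _ q hq hA hB] at hw
    obtain ⟨b, hb⟩ := IsLocalization.exist_integer_multiples_of_finite P.primeCompl w
    choose u hu using hb
    have hu' : (fun j => algebraMap A B (u j)) = algebraMap A B b • w := by
      ext j; rw [hu]; simp [Algebra.smul_def]
    have h1 : ∀ j, algebraMap A B (((D 1).map (powHom A q hq hA)).mulVec u j) =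
        algebraMap A B (b * v j) := by
      intro j
      have := congrFun (map_mulVec' (algebraMap A B) ((D 1).map (powHom A q hq hA)) u) j
      rw [← this, hu', Matrix.mulVec_smul, hw]
      simp
    have h2 : ∀ j, ∃ c : P.primeCompl, (c : A) * ((D 1).map (powHom A q hq hA)).mulVec u j =
        c * (b * v j) := fun j => (IsLocalization.eq_iff_exists P.primeCompl B).1 (h1 j)
    choose c hc using h2
    have h3 : ((∏ j, c j) * b : P.primeCompl).1 ∈ J := by
      rw [hJ]
      refine ⟨(∏ j, (c j : A)) • u, ?_⟩
      rw [Matrix.mulVec_smul]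
      ext j
      obtain ⟨d, hd⟩ := Finset.dvd_prod_of_mem (fun j => (c j : A)) (Finset.mem_univ j)
      simp only [Pi.smul_apply, smul_eq_mul, Submonoid.coe_mul, Submonoid.coe_finsetProd]
      rw [hd, mul_right_comm, hc]
      ring
    exact ((∏ j, c j) * b : P.primeCompl).2 (hJP h3)

/-- Peskine–Szpiro in all degrees. -/
theorem main' {R : Type*} [CommRing R] [IsNoetherianRing R] (q : ℕ) (hq : q ≠ 0)
    (hA : ∀ x y : R, (x + y) ^ q = x ^ q + y ^ q) (r : ℕ → ℕ)
    (D : ∀ i : ℕ, Matrix (Fin (r i)) (Fin (r (i + 1))) R) (h : FC r D) (i : ℕ) (v)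
    (hv : ((D i).map (powHom R q hq hA)).mulVec v = 0) :
    ∃ w, ((D (i + 1)).map (powHom R q hq hA)).mulVec w = v :=
  main q hq _ R (RingHom.id R) Function.surjective_id rfl hA _ _ (h.shift i) v hv

theorem baseChange_toLin {R B : Type*} [CommRing R] [CommRing B] [Algebra R B] {m n : ℕ}
    (f : (Fin m → R) →ₗ[R] (Fin n → R)) :
    Matrix.toLin' ((LinearMap.toMatrix' f).map (algebraMap R B)) ∘ₗ
      (TensorProduct.piScalarRight R B B (Fin m)).toLinearMap =
    (TensorProduct.piScalarRight R B B (Fin n)).toLinearMap ∘ₗ LinearMap.baseChange B f := by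
  apply TensorProduct.AlgebraTensorModule.ext
  intro b x
  have hfx : f x = (LinearMap.toMatrix' f).mulVec x := by
    rw [LinearMap.toMatrix'_mulVec]
  ext j
  simp only [LinearMap.comp_apply, LinearEquiv.coe_coe, LinearMap.baseChange_tmul,
    TensorProduct.piScalarRight_apply, TensorProduct.piScalarRightHom_tmul, hfx,
    Matrix.toLin'_apply, Matrix.mulVec, dotProduct, Matrix.map_apply]
  rw [Finset.sum_smul]
  refine Finset.sum_congr rfl fun k _ => ?_
  rw [Algebra.smul_def, Algebra.smul_def, map_mul, mul_assoc]

end PS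

/-- Let `R` be a Noetherian ring of prime characteristic `p`, `M` a finitely
generated `R`-module of finite projective dimension, and `G_•` a finite free resolution of
`M` (with `i`-th term `R^{r i}`, differentials `D i` and augmentation `ε`).  Then for every
`e ≥ 0` the complex `F^e(G_•)` obtained by applying the Frobenius functor (base change along
the `e`-th iterate of Frobenius) is acyclic, and it is a free resolution of
`F^e(M) = FrobTwist R p e ⊗[R] M`. -/
theorem stmt18 (R : Type*) [CommRing R] [IsNoetherianRing R] (p : ℕ) (hp : p.Prime)
    [CharP R p] [ExpChar R p]
    (M : Type*) [AddCommGroup M] [Module R M] [Module.Finite R M]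
    (r : ℕ → ℕ) (N : ℕ) (hN : ∀ i, N ≤ i → r i = 0)
    (D : ∀ i : ℕ, ((Fin (r (i + 1)) → R) →ₗ[R] (Fin (r i) → R)))
    (ε : (Fin (r 0) → R) →ₗ[R] M)
    (hεsurj : Function.Surjective ε)
    (hexact0 : Function.Exact (D 0) ε)
    (hexact : ∀ i : ℕ, Function.Exact (D (i + 1)) (D i))
    (e : ℕ) :
    Function.Surjective (LinearMap.baseChange (FrobTwist R p e) ε) ∧
      Function.Exact (LinearMap.baseChange (FrobTwist R p e) (D 0))
        (LinearMap.baseChange (FrobTwist R p e) ε) ∧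
      ∀ i : ℕ,
        Function.Exact (LinearMap.baseChange (FrobTwist R p e) (D (i + 1)))
          (LinearMap.baseChange (FrobTwist R p e) (D i)) := by
  have hε : Function.Exact (LinearMap.baseChange (FrobTwist R p e) (D 0))
      (LinearMap.baseChange (FrobTwist R p e) ε) := lTensor_exact _ hexact0 hεsurj
  refine ⟨LinearMap.lTensor_surjective _ hεsurj, hε, fun i => ?_⟩
  have hq : p ^ e ≠ 0 := pow_ne_zero _ hp.ne_zero
  have hA : ∀ x y : R, (x + y) ^ (p ^ e) = x ^ (p ^ e) + y ^ (p ^ e) := fun x y =>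
    map_add (iterateFrobenius R p e) x y
  have hFC : PS.FC r (fun i => LinearMap.toMatrix' (D i)) := by
    refine ⟨⟨N, hN⟩, fun i => ?_, fun i v hv => ?_⟩
    · rw [← LinearMap.toMatrix'_comp, (hexact i).linearMap_comp_eq_zero, map_zero]
    · rw [LinearMap.toMatrix'_mulVec] at hv
      obtain ⟨w, hw⟩ := (hexact i v).1 hv
      exact ⟨w, by rw [LinearMap.toMatrix'_mulVec, hw]⟩
  refine (Function.Exact.iff_of_ladder_linearEquiv
    (PS.baseChange_toLin (B := FrobTwist R p e) (D (i + 1)))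
    (PS.baseChange_toLin (B := FrobTwist R p e) (D i))).1 ?_
  intro v
  constructor
  · intro hv
    obtain ⟨w, hw⟩ := PS.main' (p ^ e) hq hA r _ hFC i v hv
    exact ⟨w, hw⟩
  · rintro ⟨w, rfl⟩
    have h1 := hFC.comp i
    simp only [Matrix.toLin'_apply, Matrix.mulVec_mulVec, ← Matrix.map_mul, h1]
    rw [Matrix.map_zero _ (map_zero _), Matrix.zero_mulVec]
end
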